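/- Let p ∈ (1,2) and let ω : ℝ² → ℝ be a Schwartz function. Then the Biot–Savart velocity u = K * ω is continuously differentiable on ℝ², satisfies ∂₁u₁ + ∂₂u₂ = 0 and ∂₁u₂ − ∂₂u₁ = ω everywhere on ℝ², and there exists a constant C > 0, depending only on p and not on ω, such that ‖∂ᵢu_j‖_{L^p(ℝ²)} ≤ C ‖ω‖_{L^p(ℝ²)} for all i, j ∈ {1,2}. -/

import Mathlib

open MeasureTheory Filter Real
open scoped ENNReal Topology

noncomputable section

abbrev R2 := EuclideanSpace ℝ (Fin 2)

/-- `x^⊥ = (-x₂, x₁)`. -/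
def perp (x : R2) : R2 := (WithLp.equiv 2 (Fin 2 → ℝ)).symm ![-x 1, x 0]

/-- Biot–Savart velocity `u = K * ω`. -/
def biotSavart (ω : R2 → ℝ) (x : R2) : R2 :=
  (2 * π)⁻¹ • ∫ y : R2, (ω y / ‖x - y‖ ^ 2) • perp (x - y)

/-- Partial derivative `∂ᵢ f` of a scalar function on `ℝ²`. -/
def pd (i : Fin 2) (f : R2 → ℝ) (x : R2) : ℝ := fderiv ℝ f x (EuclideanSpace.single i 1)

namespace BiotSavart

open scoped SchwartzMap LineDeriv

/-- The standard basis vectors of `ℝ²`. -/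
abbrev e (i : Fin 2) : R2 := EuclideanSpace.single i (1 : ℝ)

/-- The `i`-th partial derivative of a Schwartz function, as a Schwartz function. -/
abbrev D (i : Fin 2) (f : 𝓢(R2, ℝ)) : 𝓢(R2, ℝ) := ∂_{e i} f

/-- The heat kernel on `ℝ²` at time one. -/
def gauss (z : R2) : ℝ := (4 * π)⁻¹ * exp (-(1 / 4) * ‖z‖ ^ 2)

/-- The heat extension of `f`; `f` itself at time zero. -/
def heat (t : ℝ) (f : 𝓢(R2, ℝ)) (x : R2) : ℝ := ∫ z, gauss z * f (x - √t • z)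

lemma integral_exp_neg_mul_sq {b : ℝ} (hb : 0 < b) :
    ∫ z : R2, exp (-b * ‖z‖ ^ 2) = π / b := by
  rw [GaussianFourier.integral_rexp_neg_mul_sq_norm hb]
  simp

lemma integrable_exp_neg_mul_sq {b : ℝ} (hb : 0 < b) :
    Integrable (fun z : R2 => exp (-b * ‖z‖ ^ 2)) :=
  Integrable.of_integral_ne_zero (by rw [integral_exp_neg_mul_sq hb]; positivity)

lemma gauss_nonneg (z : R2) : 0 ≤ gauss z := by unfold gauss; positivity

@[fun_prop]
lemma continuous_gauss : Continuous gauss := by unfold gauss; fun_prop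

lemma integrable_gauss : Integrable gauss :=
  (integrable_exp_neg_mul_sq (by norm_num : (0 : ℝ) < 1 / 4)).const_mul _

lemma integral_gauss : ∫ z, gauss z = 1 := by
  unfold gauss
  rw [integral_const_mul, integral_exp_neg_mul_sq (by norm_num)]
  field_simp

lemma integrable_norm_mul_gauss : Integrable (fun z : R2 => ‖z‖ * gauss z) := by
  refine ((integrable_exp_neg_mul_sq (by norm_num : (0 : ℝ) < 1 / 8)).const_mul
    ((4 * π)⁻¹ * 2)).mono' (by fun_prop) (Eventually.of_forall fun z => ?_)
  have h1 : ‖z‖ ≤ 2 * exp (1 / 8 * ‖z‖ ^ 2) := by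
    nlinarith [add_one_le_exp (1 / 8 * ‖z‖ ^ 2), sq_nonneg (‖z‖ - 2)]
  rw [norm_of_nonneg (mul_nonneg (norm_nonneg z) (gauss_nonneg z))]
  unfold gauss
  calc ‖z‖ * ((4 * π)⁻¹ * exp (-(1 / 4) * ‖z‖ ^ 2))
      ≤ (2 * exp (1 / 8 * ‖z‖ ^ 2)) * ((4 * π)⁻¹ * exp (-(1 / 4) * ‖z‖ ^ 2)) := by gcongr
    _ = (4 * π)⁻¹ * 2 * (exp (1 / 8 * ‖z‖ ^ 2) * exp (-(1 / 4) * ‖z‖ ^ 2)) := by ring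
    _ = _ := by rw [← exp_add]; ring_nf

lemma abs_coord_le (z : R2) (i : Fin 2) : |z i| ≤ ‖z‖ := by
  simpa using PiLp.norm_apply_le z i

lemma abs_le_seminorm (f : 𝓢(R2, ℝ)) (x : R2) : |f x| ≤ SchwartzMap.seminorm ℝ 0 0 f :=
  f.norm_le_seminorm ℝ x

lemma hasDerivAt_line (f : 𝓢(R2, ℝ)) (i : Fin 2) (x : R2) (s : ℝ) :
    HasDerivAt (fun s : ℝ => f (x + s • e i)) (D i f (x + s • e i)) s := by
  have h := (f.hasFDerivAt (x + s • e i)).comp_hasDerivAt s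
    (((hasDerivAt_id s).smul_const (e i)).const_add x)
  simpa [D, SchwartzMap.lineDerivOp_apply_eq_fderiv, Function.comp_def] using h

lemma hasLineDerivAt (f : 𝓢(R2, ℝ)) (i : Fin 2) (x : R2) :
    HasLineDerivAt ℝ f (D i f x) x (e i) := by
  simpa [HasLineDerivAt] using hasDerivAt_line f i x 0

lemma fderiv_apply (f : 𝓢(R2, ℝ)) (x z : R2) :
    fderiv ℝ f x z = ∑ i, z i * D i f x := by
  have hz : z = ∑ i, z i • e i := by
    ext j; fin_cases j <;> simp [e, Fin.sum_univ_two]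
  conv_lhs => rw [hz]
  simp [D, SchwartzMap.lineDerivOp_apply_eq_fderiv]

lemma D_comm (i j : Fin 2) (f : 𝓢(R2, ℝ)) : D i (D j f) = D j (D i f) := by
  have key : ∀ (i j : Fin 2) (x : R2),
      D i (D j f) x = fderiv ℝ (fderiv ℝ f) x (e i) (e j) := by
    intro i j x
    have h : (D j f : R2 → ℝ) = fun y => fderiv ℝ f y (e j) := by
      ext y; simp [D, SchwartzMap.lineDerivOp_apply_eq_fderiv]
    have h2 : DifferentiableAt ℝ (fderiv ℝ f) x :=
      ((f.smooth 2).fderiv_right (m := 1) (by norm_num)).differentiable (by norm_num) x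
    rw [show D i (D j f) x = fderiv ℝ (D j f : R2 → ℝ) x (e i) from
      SchwartzMap.lineDerivOp_apply_eq_fderiv _ _ _, h,
      fderiv_clm_apply h2 (differentiableAt_const _)]
    simp
  ext x
  rw [key, key]
  exact ((f.smooth 2).contDiffAt.isSymmSndFDerivAt (by simp)) _ _

lemma integrable_gauss_mul (t : ℝ) (f : 𝓢(R2, ℝ)) (x : R2) :
    Integrable (fun z => gauss z * f (x - √t • z)) :=
  integrable_gauss.mul_bdd (c := SchwartzMap.seminorm ℝ 0 0 f)
    (f.continuous.comp (by fun_prop)).aestronglyMeasurable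
    (Eventually.of_forall fun z => abs_le_seminorm f _)

lemma integrable_coord_gauss_mul (i : Fin 2) (t : ℝ) (f : 𝓢(R2, ℝ)) (x : R2) :
    Integrable (fun z : R2 => z i * gauss z * f (x - √t • z)) := by
  refine Integrable.mul_bdd (c := SchwartzMap.seminorm ℝ 0 0 f) ?_
    (f.continuous.comp (by fun_prop)).aestronglyMeasurable
    (Eventually.of_forall fun z => abs_le_seminorm f _)
  refine integrable_norm_mul_gauss.mono' (by fun_prop) (Eventually.of_forall fun z => ?_)
  rw [norm_mul, norm_of_nonneg (gauss_nonneg z)]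
  exact mul_le_mul_of_nonneg_right (abs_coord_le z i) (gauss_nonneg z)

lemma abs_heat_le (t : ℝ) (f : 𝓢(R2, ℝ)) (x : R2) :
    |heat t f x| ≤ SchwartzMap.seminorm ℝ 0 0 f := by
  calc |heat t f x| ≤ ∫ z, gauss z * SchwartzMap.seminorm ℝ 0 0 f := by
        rw [← norm_eq_abs, heat]
        refine norm_integral_le_of_norm_le (integrable_gauss.mul_const _)
          (Eventually.of_forall fun z => ?_)
        rw [norm_mul, norm_of_nonneg (gauss_nonneg z)]
        exact mul_le_mul_of_nonneg_left (abs_le_seminorm f _) (gauss_nonneg z)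
    _ = _ := by rw [integral_mul_const, integral_gauss, one_mul]

lemma continuous_heat (f : 𝓢(R2, ℝ)) : Continuous (fun q : ℝ × R2 => heat q.1 f q.2) := by
  refine continuous_of_dominated (bound := fun z => gauss z * SchwartzMap.seminorm ℝ 0 0 f)
    (fun q => (integrable_gauss_mul _ _ _).aestronglyMeasurable) (fun q => ?_)
    (integrable_gauss.mul_const _) ?_
  · refine Eventually.of_forall fun z => ?_
    rw [norm_mul, norm_of_nonneg (gauss_nonneg z)]
    exact mul_le_mul_of_nonneg_left (abs_le_seminorm f _) (gauss_nonneg z)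
  · refine Eventually.of_forall fun z => continuous_const.mul (f.continuous.comp ?_)
    fun_prop

lemma heat_zero (f : 𝓢(R2, ℝ)) (x : R2) : heat 0 f x = f x := by
  simp [heat, integral_mul_const, integral_gauss]

lemma heat_hasLineDerivAt (t : ℝ) (f : 𝓢(R2, ℝ)) (i : Fin 2) (x : R2) :
    HasLineDerivAt ℝ (heat t f) (heat t (D i f) x) x (e i) := by
  have key := hasDerivAt_integral_of_dominated_loc_of_deriv_le (μ := volume) (s := Set.univ)
    (F := fun (s : ℝ) z => gauss z * f ((x + s • e i) - √t • z))
    (F' := fun (s : ℝ) z => gauss z * D i f ((x + s • e i) - √t • z)) (x₀ := 0)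
    (bound := fun z => gauss z * SchwartzMap.seminorm ℝ 0 0 (D i f)) univ_mem
    (Eventually.of_forall fun s => (integrable_gauss_mul _ _ _).aestronglyMeasurable)
    (integrable_gauss_mul _ _ _) (integrable_gauss_mul _ _ _).aestronglyMeasurable
    (Eventually.of_forall fun z s _ => ?_) (integrable_gauss.mul_const _)
    (Eventually.of_forall fun z s _ => ?_)
  · simpa [HasLineDerivAt, heat] using key.2
  · rw [norm_mul, norm_of_nonneg (gauss_nonneg z)]
    exact mul_le_mul_of_nonneg_left (abs_le_seminorm _ _) (gauss_nonneg z)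
  · have := (hasDerivAt_line f i (x - √t • z) s).const_mul (gauss z)
    simpa only [sub_add_eq_add_sub] using this

lemma gauss_hasLineDerivAt (i : Fin 2) (z : R2) :
    HasLineDerivAt ℝ gauss (-(z i * gauss z / 2)) z (e i) := by
  have h1 : HasFDerivAt (fun z : R2 => ‖z‖ ^ 2) (2 • innerSL ℝ z) z := by
    simpa using (hasStrictFDerivAt_norm_sq z).hasFDerivAt
  have h2 := ((h1.const_mul (-(1 / 4) : ℝ)).exp.const_mul ((4 * π)⁻¹)).hasLineDerivAt (e i)
  have h3 : inner ℝ z (e i) = z i := by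
    simp [EuclideanSpace.inner_single_right]
  unfold gauss
  refine HasDerivAt.congr_deriv h2 ?_
  simp only [smul_apply, innerSL_apply_apply, h3, nsmul_eq_mul, smul_eq_mul]
  push_cast
  ring

/-- Gaussian integration by parts. -/
lemma integral_coord_gauss_mul (i : Fin 2) (t : ℝ) (f : 𝓢(R2, ℝ)) (x : R2) :
    ∫ z : R2, z i * gauss z * f (x - √t • z) = -(2 * √t) * heat t (D i f) x := by
  have key := integral_bilinear_hasLineDerivAt_right_eq_neg_left_of_integrable (μ := volume)
    (B := ContinuousLinearMap.mul ℝ ℝ) (f := fun z => f (x - √t • z)) (v := e i)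
    (f' := fun z => -√t * D i f (x - √t • z))
    (g := gauss) (g' := fun z => -(z i * gauss z / 2)) ?_ ?_ ?_ ?_ ?_
  · simp only [ContinuousLinearMap.mul_apply'] at key
    calc ∫ z : R2, z i * gauss z * f (x - √t • z)
        = -2 * ∫ z : R2, f (x - √t • z) * (-(z i * gauss z / 2)) := by
          rw [← integral_const_mul]; congr 1; ext z; ring
      _ = -2 * -∫ z : R2, -√t * (gauss z * D i f (x - √t • z)) := by
          rw [key]; congr 3; ext z; ring
      _ = _ := by rw [integral_const_mul, heat]; ring
  · refine ((integrable_gauss_mul t (D i f) x).const_mul (-√t)).congr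
      (Eventually.of_forall fun z => ?_)
    simp; ring
  · refine ((integrable_coord_gauss_mul i t f x).const_mul (-1/2)).congr
      (Eventually.of_forall fun z => ?_)
    simp; ring
  · refine (integrable_gauss_mul t f x).congr (Eventually.of_forall fun z => ?_)
    simp; ring
  · intro z _
    have h := (hasDerivAt_line f i (x - √t • z) 0).scomp_of_eq (0 : ℝ)
      ((hasDerivAt_id (0 : ℝ)).const_mul (-√t)) (by simp)
    simp only [HasLineDerivAt]
    convert h using 1
    · ext s
      simp only [Function.comp, id]
      congr 1
      module
    · simp
  · exact fun z _ => gauss_hasLineDerivAt i z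

lemma heat_hasDerivAt {t : ℝ} (ht : 0 < t) (f : 𝓢(R2, ℝ)) (x : R2) :
    HasDerivAt (fun t => heat t f x) (∑ i, heat t (D i (D i f)) x) t := by
  have hs : ∀ i, ∫ z : R2, z i * gauss z * D i f (x - √t • z) =
    -(2 * √t) * heat t (D i (D i f)) x := fun i => integral_coord_gauss_mul i t (D i f) x
  have hF' : Integrable (fun z : R2 =>
      ∑ i, -(1 / (2 * √t)) * (z i * gauss z * D i f (x - √t • z))) :=
    integrable_finsetSum _ fun i _ => (integrable_coord_gauss_mul i t (D i f) x).const_mul _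
  have hb : Integrable (fun z : R2 =>
      ∑ i, 1 / √t * SchwartzMap.seminorm ℝ 0 0 (D i f) * (‖z‖ * gauss z)) :=
    integrable_finsetSum _ fun i _ => integrable_norm_mul_gauss.const_mul _
  have key := hasDerivAt_integral_of_dominated_loc_of_deriv_le (μ := volume)
    (s := Set.Ioi (t / 4))
    (F := fun (s : ℝ) z => gauss z * f (x - √s • z))
    (F' := fun (s : ℝ) z => ∑ i, -(1 / (2 * √s)) * (z i * gauss z * D i f (x - √s • z))) (x₀ := t)
    (bound := fun z => ∑ i, 1 / √t * SchwartzMap.seminorm ℝ 0 0 (D i f) * (‖z‖ * gauss z))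
    (Ioi_mem_nhds (by linarith))
    (Eventually.of_forall fun s => (integrable_gauss_mul _ _ _).aestronglyMeasurable)
    (integrable_gauss_mul _ _ _)
    hF'.aestronglyMeasurable
    (Eventually.of_forall fun z s hs => ?_)
    hb
    (Eventually.of_forall fun z s hs => ?_)
  · refine key.2.congr_deriv ?_
    rw [integral_finsetSum _ fun i _ =>
      (integrable_coord_gauss_mul i t (D i f) x).const_mul _]
    refine Finset.sum_congr rfl fun i _ => ?_
    rw [integral_const_mul, hs]
    have : √t ≠ 0 := by positivity
    field_simp
  · have hs0 : √t / 2 ≤ √s := by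
      have : √(t / 4) = √t / 2 := by
        rw [sqrt_div ht.le, show (4 : ℝ) = 2 ^ 2 by norm_num, sqrt_sq (by norm_num)]
      rw [← this]
      exact sqrt_le_sqrt (le_of_lt hs)
    have ht0 : 0 < √t := by positivity
    refine (norm_sum_le _ _).trans (Finset.sum_le_sum fun i _ => ?_)
    rw [norm_mul, norm_mul, norm_mul, norm_neg, norm_of_nonneg (gauss_nonneg z),
      norm_of_nonneg (by positivity)]
    have h1 : 1 / (2 * √s) ≤ 1 / √t := one_div_le_one_div_of_le ht0 (by linarith)
    calc 1 / (2 * √s) * (‖z i‖ * gauss z * ‖D i f (x - √s • z)‖)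
        ≤ 1 / √t * (‖z‖ * gauss z * SchwartzMap.seminorm ℝ 0 0 (D i f)) := by
          have := gauss_nonneg z
          gcongr
          · exact abs_coord_le z i
          · exact abs_le_seminorm _ _
      _ = _ := by ring
  · have hs0 : 0 < s := lt_trans (by positivity) hs
    have h := (f.hasFDerivAt (x - √s • z)).comp_hasDerivAt s
      (((hasDerivAt_sqrt hs0.ne').smul_const z).const_sub x)
    have h' := h.const_mul (gauss z)
    refine h'.congr_deriv ?_
    rw [map_neg, map_smul, fderiv_apply, smul_eq_mul, Finset.mul_sum, ← Finset.sum_neg_distrib,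
      Finset.mul_sum]
    refine Finset.sum_congr rfl fun i _ => ?_
    ring

/-- Heat extensions are integrable in space and time over finite time intervals. -/
lemma integrable_heat_prod (μ : Measure ℝ) [IsFiniteMeasure μ] (f : 𝓢(R2, ℝ)) :
    Integrable (fun q : ℝ × R2 => heat q.1 f q.2) (μ.prod volume) := by
  have hc : Continuous fun r : (ℝ × R2) × R2 => gauss r.2 * f (r.1.2 - √r.1.1 • r.2) :=
    (continuous_gauss.comp continuous_snd).mul (f.continuous.comp (by fun_prop))
  have hz : ∀ z : R2, Integrable (fun q : ℝ × R2 => f (q.2 - √q.1 • z)) (μ.prod volume) := by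
    intro z
    have hc' : Continuous fun q : ℝ × R2 => f (q.2 - √q.1 • z) := f.continuous.comp (by fun_prop)
    rw [integrable_prod_iff hc'.aestronglyMeasurable]
    refine ⟨Eventually.of_forall fun t => f.integrable.comp_sub_right (√t • z), ?_⟩
    simp only [integral_sub_right_eq_self (fun x => ‖f x‖)]
    exact integrable_const _
  have hn : ∀ z : R2, ∫ q : ℝ × R2, ‖f (q.2 - √q.1 • z)‖ ∂(μ.prod volume) =
      μ.real Set.univ * ∫ x, ‖f x‖ := by
    intro z
    rw [integral_prod _ (hz z).norm]
    simp only [integral_sub_right_eq_self (fun x => ‖f x‖)]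
    simp
  have key : Integrable (fun r : (ℝ × R2) × R2 => gauss r.2 * f (r.1.2 - √r.1.1 • r.2))
      ((μ.prod volume).prod volume) := by
    rw [integrable_prod_iff' hc.aestronglyMeasurable]
    refine ⟨Eventually.of_forall fun z => (hz z).const_mul (gauss z), ?_⟩
    simp only [norm_mul, integral_const_mul, hn]
    exact integrable_gauss.norm.mul_const _
  exact key.integral_prod_left

lemma integrable_heat (t : ℝ) (f : 𝓢(R2, ℝ)) : Integrable (heat t f) := by
  have h := integrable_heat_prod (Measure.dirac t) f
  rw [Measure.dirac_prod, integrable_map_measure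
    (continuous_heat f).aestronglyMeasurable (by fun_prop)] at h
  exact h

lemma abs_heat_le_div {t : ℝ} (ht : 0 < t) (f : 𝓢(R2, ℝ)) (x : R2) :
    |heat t f x| ≤ (4 * π)⁻¹ * (t⁻¹ * ∫ z, |f z|) := by
  have hs : 0 < √t := by positivity
  have h1 : Integrable (fun z => |f (x - √t • z)|) :=
    ((f.integrable.abs.comp_sub_left x).comp_smul hs.ne')
  have h2 : ∫ z, |f (x - √t • z)| = t⁻¹ * ∫ z, |f z| := by
    rw [Measure.integral_comp_smul volume (fun z => |f (x - z)|) (√t),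
      integral_sub_left_eq_self (fun z => |f z|)]
    simp [sq_sqrt ht.le, abs_of_pos ht]
  rw [← h2, ← integral_const_mul, ← norm_eq_abs, heat]
  refine norm_integral_le_of_norm_le (h1.const_mul _) (Eventually.of_forall fun z => ?_)
  rw [norm_mul, norm_of_nonneg (gauss_nonneg z)]
  refine mul_le_mul_of_nonneg_right ?_ (abs_nonneg _)
  unfold gauss
  exact mul_le_of_le_one_right (by positivity) (exp_le_one_iff.2 (by nlinarith [sq_nonneg ‖z‖]))

lemma gauss_mul_gauss (v z : R2) :
    gauss z * gauss (√2 • v - z) =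
      (4 * π)⁻¹ * gauss v * exp (-(1 / 2) * ‖z - (√2)⁻¹ • v‖ ^ 2) := by
  have h2 : (√2) ^ 2 = 2 := sq_sqrt (by norm_num)
  have h2' : (√2)⁻¹ = √2 / 2 := by
    rw [inv_eq_one_div, div_eq_div_iff (by positivity) (by norm_num)]; nlinarith
  unfold gauss
  rw [show (4 * π)⁻¹ * rexp (-(1 / 4) * ‖z‖ ^ 2) * ((4 * π)⁻¹ * rexp (-(1 / 4) * ‖√2 • v - z‖ ^ 2))
    = (4 * π)⁻¹ * (4 * π)⁻¹ * (rexp (-(1 / 4) * ‖z‖ ^ 2) * rexp (-(1 / 4) * ‖√2 • v - z‖ ^ 2)) by ring,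
    show (4 * π)⁻¹ * ((4 * π)⁻¹ * rexp (-(1 / 4) * ‖v‖ ^ 2)) *
      rexp (-(1 / 2) * ‖z - (√2)⁻¹ • v‖ ^ 2) = (4 * π)⁻¹ * (4 * π)⁻¹ * (rexp (-(1 / 4) * ‖v‖ ^ 2) *
      rexp (-(1 / 2) * ‖z - (√2)⁻¹ • v‖ ^ 2)) by ring, ← exp_add, ← exp_add]
  congr 2
  rw [norm_sub_sq_real, norm_sub_sq_real, h2', norm_smul, norm_smul, inner_smul_left,
    inner_smul_right, real_inner_comm z v, norm_of_nonneg (by positivity : (0 : ℝ) ≤ √2),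
    norm_of_nonneg (by positivity : (0 : ℝ) ≤ √2 / 2), mul_pow, mul_pow, div_pow, h2]
  simp
  ring

lemma integral_gauss_mul_gauss (v : R2) :
    ∫ z, gauss z * gauss (√2 • v - z) = gauss v / 2 := by
  simp only [gauss_mul_gauss]
  rw [integral_const_mul,
    integral_sub_right_eq_self (fun z : R2 => rexp (-(1 / 2) * ‖z‖ ^ 2)),
    integral_exp_neg_mul_sq (by norm_num)]
  field_simp
  ring

lemma integrable_gauss_mul_gauss :
    Integrable (fun q : R2 × R2 => gauss q.2 * gauss (√2 • q.1 - q.2)) := by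
  have hg := (integrable_exp_neg_mul_sq (by norm_num : (0 : ℝ) < 1 / 8))
  refine ((hg.mul_prod hg).const_mul ((4 * π)⁻¹ * (4 * π)⁻¹)).mono' (by fun_prop)
    (Eventually.of_forall fun q => ?_)
  obtain ⟨v, z⟩ := q
  rw [norm_of_nonneg (mul_nonneg (gauss_nonneg _) (gauss_nonneg _))]
  have h2 : (√2) ^ 2 = 2 := sq_sqrt (by norm_num)
  unfold gauss
  simp only
  rw [show (4 * π)⁻¹ * rexp (-(1 / 4) * ‖z‖ ^ 2) * ((4 * π)⁻¹ * rexp (-(1 / 4) * ‖√2 • v - z‖ ^ 2))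
    = (4 * π)⁻¹ * (4 * π)⁻¹ * (rexp (-(1 / 4) * ‖z‖ ^ 2) * rexp (-(1 / 4) * ‖√2 • v - z‖ ^ 2)) by ring,
    ← exp_add, ← exp_add]
  refine mul_le_mul_of_nonneg_left ?_ (by positivity)
  refine exp_le_exp.2 ?_
  have hi := real_inner_le_norm v z
  rw [norm_sub_sq_real, norm_smul, inner_smul_left, norm_of_nonneg (by positivity : (0 : ℝ) ≤ √2),
    mul_pow, h2]
  have h3 : 0 < √2 := by positivity
  have h4 : √2 * inner ℝ v z ≤ √2 * (‖v‖ * ‖z‖) := by gcongr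
  simp only [conj_trivial]
  nlinarith [sq_nonneg (3 * ‖v‖ - 2 * √2 * ‖z‖)]

lemma integral_gauss_mul_heat (s : ℝ) (f : 𝓢(R2, ℝ)) (x : R2) :
    ∫ z, gauss z * heat s f (x - √s • z) = heat (2 * s) f x := by
  have h2 : 0 < √2 := by positivity
  have h22 : (√2) ^ 2 = 2 := sq_sqrt (by norm_num)
  have hin : ∀ z, heat s f (x - √s • z) =
      2 * ∫ v, gauss (√2 • v - z) * f (x - √(2 * s) • v) := by
    intro z
    have e1 := Measure.integral_comp_smul (volume : Measure R2)
      (fun w => gauss (w - z) * f (x - √s • z - √s • (w - z))) (√2)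
    rw [integral_sub_right_eq_self (fun w => gauss w * f (x - √s • z - √s • w))] at e1
    rw [heat]
    have : ∀ v : R2, x - √s • z - √s • (√2 • v - z) = x - √(2 * s) • v := by
      intro v
      rw [sqrt_mul (by norm_num), mul_comm (√2), mul_smul]
      module
    simp only [this] at e1
    rw [e1]
    simp [h22]
  simp only [hin]
  have hInt : Integrable (fun q : R2 × R2 =>
      gauss q.2 * gauss (√2 • q.1 - q.2) * f (x - √(2 * s) • q.1)) :=
    integrable_gauss_mul_gauss.mul_bdd (c := SchwartzMap.seminorm ℝ 0 0 f)
      (f.continuous.comp (by fun_prop)).aestronglyMeasurable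
      (Eventually.of_forall fun q => abs_le_seminorm f _)
  calc ∫ z, gauss z * (2 * ∫ v, gauss (√2 • v - z) * f (x - √(2 * s) • v))
      = 2 * ∫ z, ∫ v, gauss z * gauss (√2 • v - z) * f (x - √(2 * s) • v) := by
        rw [← integral_const_mul]
        congr 1; ext z
        simp only [mul_assoc]
        rw [integral_const_mul]; ring
    _ = 2 * ∫ v, ∫ z, gauss z * gauss (√2 • v - z) * f (x - √(2 * s) • v) := by
        congr 1
        exact (integral_integral_swap hInt).symm
    _ = _ := by
        simp only [integral_mul_const, integral_gauss_mul_gauss]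
        rw [← integral_const_mul, heat]
        congr 1; ext v; ring

/-- The symmetric form of the semigroup property. -/
lemma integral_heat_mul_heat (s : ℝ) (f g : 𝓢(R2, ℝ)) :
    ∫ x, heat s f x * heat s g x = ∫ x, heat (2 * s) f x * g x := by
  have hInt : Integrable (fun q : R2 × R2 => gauss q.2 * g (q.1 - √s • q.2) * heat s f q.1) := by
    have h1 : Integrable (fun q : R2 × R2 => gauss q.2 * g (q.1 - √s • q.2)) := by
      have hc : Continuous fun q : R2 × R2 => gauss q.2 * g (q.1 - √s • q.2) :=
        (continuous_gauss.comp continuous_snd).mul (g.continuous.comp (by fun_prop))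
      rw [Measure.volume_eq_prod, integrable_prod_iff' hc.aestronglyMeasurable]
      refine ⟨Eventually.of_forall fun z => (g.integrable.comp_sub_right (√s • z)).const_mul (gauss z), ?_⟩
      simp only [norm_mul, integral_const_mul, integral_sub_right_eq_self (fun x => ‖g x‖)]
      exact integrable_gauss.norm.mul_const _
    refine h1.mul_bdd (c := SchwartzMap.seminorm ℝ 0 0 f) ?_
      (Eventually.of_forall fun q => abs_heat_le _ _ _)
    exact ((continuous_heat f).comp
      ((continuous_const (y := s)).prodMk continuous_fst)).aestronglyMeasurable
  have hInt2 : Integrable (fun q : R2 × R2 => gauss q.2 * heat s f (q.1 - √s • q.2) * g q.1) := by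
    have h1 : Integrable (fun q : R2 × R2 => g q.1 * gauss q.2) :=
      g.integrable.mul_prod integrable_gauss
    have h2 := h1.mul_bdd (g := fun q : R2 × R2 => heat s f (q.1 - √s • q.2))
      (c := SchwartzMap.seminorm ℝ 0 0 f) ((continuous_heat f).comp
      ((continuous_const (y := s)).prodMk (by fun_prop))).aestronglyMeasurable
      (Eventually.of_forall fun q => abs_heat_le _ _ _)
    exact h2.congr (Eventually.of_forall fun q => by simp only; ring)
  calc ∫ x, heat s f x * heat s g x
      = ∫ x, ∫ z, gauss z * g (x - √s • z) * heat s f x := by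
        congr 1; ext x
        rw [integral_mul_const, mul_comm]; rfl
    _ = ∫ z, ∫ x, gauss z * g (x - √s • z) * heat s f x := integral_integral_swap hInt
    _ = ∫ z, ∫ x, gauss z * heat s f (x + √s • z) * g x := by
        congr 1; ext z
        rw [← integral_add_right_eq_self _ (√s • z)]
        congr 1; ext x
        rw [add_sub_cancel_right]; ring
    _ = ∫ z, ∫ x, gauss z * heat s f (x - √s • z) * g x := by
        rw [← integral_neg_eq_self]
        congr 1; ext z
        congr 1; ext x
        simp [gauss, sub_eq_add_neg]
    _ = ∫ x, ∫ z, gauss z * heat s f (x - √s • z) * g x := (integral_integral_swap hInt2).symm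
    _ = _ := by
        congr 1; ext x
        rw [integral_mul_const, integral_gauss_mul_heat]

/-- The gradient of minus the Newtonian potential on `ℝ²`. -/
def newton (j : Fin 2) (z : R2) : ℝ := -z j / (2 * π * ‖z‖ ^ 2)

/-- The convolution of a Schwartz function with a component of the Newtonian gradient. -/
def conv (j : Fin 2) (v : 𝓢(R2, ℝ)) (x : R2) : ℝ := ∫ z, newton j z * v (x - z)

lemma exists_decay {V : Type*} [NormedAddCommGroup V] [NormedSpace ℝ V] (F : 𝓢(R2, V)) :
    ∃ C, 0 ≤ C ∧ ∀ x z, ‖F (x - z)‖ ≤ C * (1 + ‖x‖) ^ 4 * ((1 + ‖z‖) ^ 4)⁻¹ := by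
  refine ⟨2 ^ 4 * (Finset.Iic ((4, 0) : ℕ × ℕ)).sup
    (fun m => SchwartzMap.seminorm ℝ m.1 m.2) F, by positivity, fun x z => ?_⟩
  have h := SchwartzMap.one_add_le_sup_seminorm_apply (𝕜 := ℝ) (m := (4, 0)) (k := 4) (n := 0)
    le_rfl le_rfl F (x - z)
  rw [norm_iteratedFDeriv_zero] at h
  have h1 : 1 + ‖z‖ ≤ (1 + ‖x - z‖) * (1 + ‖x‖) := by
    have := norm_sub_norm_le z x
    rw [norm_sub_rev] at this
    nlinarith [norm_nonneg (x - z), norm_nonneg x]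
  have h2 : (1 + ‖z‖) ^ 4 ≤ (1 + ‖x - z‖) ^ 4 * (1 + ‖x‖) ^ 4 := by
    rw [← mul_pow]; gcongr
  rw [← div_eq_mul_inv, le_div_iff₀ (by positivity)]
  calc ‖F (x - z)‖ * (1 + ‖z‖) ^ 4
      ≤ ‖F (x - z)‖ * ((1 + ‖x - z‖) ^ 4 * (1 + ‖x‖) ^ 4) := by gcongr
    _ = ((1 + ‖x - z‖) ^ 4 * ‖F (x - z)‖) * (1 + ‖x‖) ^ 4 := by ring
    _ ≤ _ := by gcongr

lemma integrableOn_one_add_pow_inv {n : ℕ} (hn : 1 < n) :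
    IntegrableOn (fun r : ℝ => ((1 + r) ^ n)⁻¹) (Set.Ioi 0) := by
  have h := (integrable_one_add_norm (E := ℝ) (μ := volume) (r := n)
    (by simpa using hn)).integrableOn (s := Set.Ioi 0)
  refine h.congr_fun (fun r hr => ?_) measurableSet_Ioi
  have hr0 : (0 : ℝ) < r := hr
  simp only [norm_of_nonneg hr0.le]
  rw [rpow_neg (by positivity), rpow_natCast]

lemma integrable_inv_norm_mul :
    Integrable (fun z : R2 => ‖z‖⁻¹ * ((1 + ‖z‖) ^ 4)⁻¹) := by
  refine (integrable_fun_norm_addHaar (μ := (volume : Measure R2))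
    (f := fun r : ℝ => r⁻¹ * ((1 + r) ^ 4)⁻¹)).2 ?_
  refine (integrableOn_one_add_pow_inv (n := 4) (by norm_num)).congr_fun
    (fun r hr => ?_) measurableSet_Ioi
  have hr0 : (0 : ℝ) < r := hr
  simp [hr0.ne']

lemma integrable_norm_mul :
    Integrable (fun z : R2 => ‖z‖ * ((1 + ‖z‖) ^ 4)⁻¹) := by
  refine (integrable_fun_norm_addHaar (μ := (volume : Measure R2))
    (f := fun r : ℝ => r * ((1 + r) ^ 4)⁻¹)).2 ?_
  refine (integrableOn_one_add_pow_inv (n := 2) (by norm_num)).mono' 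
    (by measurability) ((ae_restrict_iff' measurableSet_Ioi).2 (Eventually.of_forall fun r hr => ?_))
  have hr0 : (0 : ℝ) < r := hr
  simp only [finrank_euclideanSpace, Fintype.card_fin, smul_eq_mul]
  rw [norm_of_nonneg (by positivity), ← mul_assoc, ← div_eq_mul_inv, inv_eq_one_div,
    div_le_div_iff₀ (by positivity) (by positivity)]
  have : (1 + r) ^ 4 = (1 + r) ^ 2 * (1 + r) ^ 2 := by ring
  rw [this, one_mul]
  gcongr
  norm_num
  nlinarith

lemma measurable_newton (j : Fin 2) : Measurable (newton j) := by unfold newton; fun_prop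

lemma abs_newton_le (j : Fin 2) (z : R2) : |newton j z| ≤ ‖z‖⁻¹ := by
  rcases eq_or_ne z 0 with rfl | hz
  · simp [newton]
  have hz0 : 0 < ‖z‖ := norm_pos_iff.2 hz
  rw [newton, abs_div, abs_neg, abs_of_pos (by positivity : 0 < 2 * π * ‖z‖ ^ 2),
    inv_eq_one_div, div_le_div_iff₀ (by positivity) hz0]
  have h1 : 1 ≤ 2 * π := by linarith [pi_gt_three]
  calc |z j| * ‖z‖ ≤ ‖z‖ * ‖z‖ := by gcongr; exact abs_coord_le z j
    _ = 1 * (1 * ‖z‖ ^ 2) := by ring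
    _ ≤ _ := by gcongr

lemma exists_newton_bound {V : Type*} [NormedAddCommGroup V] [NormedSpace ℝ V] (F : 𝓢(R2, V))
    (R : ℝ) : ∃ b : R2 → ℝ, Integrable b ∧
      ∀ x z, ‖x‖ ≤ R → ‖z‖⁻¹ * ‖F (x - z)‖ ≤ b z := by
  obtain ⟨C, hC0, hC⟩ := exists_decay F
  refine ⟨fun z => C * (1 + R) ^ 4 * (‖z‖⁻¹ * ((1 + ‖z‖) ^ 4)⁻¹),
    integrable_inv_norm_mul.const_mul _, fun x z hx => ?_⟩
  calc ‖z‖⁻¹ * ‖F (x - z)‖ ≤ ‖z‖⁻¹ * (C * (1 + ‖x‖) ^ 4 * ((1 + ‖z‖) ^ 4)⁻¹) := by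
        gcongr; exact hC x z
    _ ≤ ‖z‖⁻¹ * (C * (1 + R) ^ 4 * ((1 + ‖z‖) ^ 4)⁻¹) := by gcongr
    _ = _ := by ring

lemma integrable_newton_smul {V : Type*} [NormedAddCommGroup V] [NormedSpace ℝ V]
    (F : 𝓢(R2, V)) (j : Fin 2) (x : R2) : Integrable (fun z => newton j z • F (x - z)) := by
  obtain ⟨b, hb, hle⟩ := exists_newton_bound F ‖x‖
  refine hb.mono' ((measurable_newton j).aestronglyMeasurable.smul
    (F.continuous.comp (by fun_prop)).aestronglyMeasurable) (Eventually.of_forall fun z => ?_)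
  rw [norm_smul]
  exact (mul_le_mul_of_nonneg_right (abs_newton_le j z) (norm_nonneg _)).trans (hle x z le_rfl)

lemma hasFDerivAt_conv (j : Fin 2) (v : 𝓢(R2, ℝ)) (x : R2) :
    HasFDerivAt (conv j v) (∫ z, newton j z • fderiv ℝ v (x - z)) x := by
  obtain ⟨b, hb, hle⟩ := exists_newton_bound (SchwartzMap.fderivCLM ℝ R2 ℝ v) (‖x‖ + 1)
  refine hasFDerivAt_integral_of_dominated_of_fderiv_le (s := Metric.ball x 1) (bound := b)
    (F := fun x z => newton j z * v (x - z))
    (F' := fun x z => newton j z • fderiv ℝ v (x - z)) (Metric.ball_mem_nhds x one_pos)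
    (Eventually.of_forall fun y => (integrable_newton_smul v j y).aestronglyMeasurable)
    (integrable_newton_smul v j x)
    (integrable_newton_smul (SchwartzMap.fderivCLM ℝ R2 ℝ v) j x).aestronglyMeasurable
    (Eventually.of_forall fun z y hy => ?_) hb (Eventually.of_forall fun z y hy => ?_)
  · rw [norm_smul]
    refine (mul_le_mul_of_nonneg_right (abs_newton_le j z) (norm_nonneg _)).trans (hle y z ?_)
    have := norm_sub_norm_le y x
    rw [Metric.mem_ball, dist_eq_norm] at hy
    linarith
  · have h := ((v.hasFDerivAt (y - z)).comp y ((hasFDerivAt_id y).sub_const z)).const_mul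
      (newton j z)
    exact h

lemma continuous_fderiv_conv (j : Fin 2) (v : 𝓢(R2, ℝ)) :
    Continuous fun x => ∫ z, newton j z • fderiv ℝ v (x - z) := by
  refine continuous_iff_continuousAt.2 fun x => ?_
  obtain ⟨b, hb, hle⟩ := exists_newton_bound (SchwartzMap.fderivCLM ℝ R2 ℝ v) (‖x‖ + 1)
  refine continuousAt_of_dominated (bound := b)
    (Eventually.of_forall fun y =>
      (integrable_newton_smul (SchwartzMap.fderivCLM ℝ R2 ℝ v) j y).aestronglyMeasurable)
    ?_ hb (Eventually.of_forall fun z => ?_)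
  · filter_upwards [Metric.ball_mem_nhds x one_pos] with y hy
    refine Eventually.of_forall fun z => ?_
    rw [norm_smul]
    refine (mul_le_mul_of_nonneg_right (abs_newton_le j z) (norm_nonneg _)).trans (hle y z ?_)
    have := norm_sub_norm_le y x
    rw [Metric.mem_ball, dist_eq_norm] at hy
    linarith
  · exact (((SchwartzMap.fderivCLM ℝ R2 ℝ v).continuous.comp
      (by fun_prop : Continuous fun y : R2 => y - z)).const_smul (newton j z)).continuousAt

lemma contDiff_conv (j : Fin 2) (v : 𝓢(R2, ℝ)) : ContDiff ℝ 1 (conv j v) := by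
  rw [contDiff_one_iff_fderiv]
  refine ⟨fun x => (hasFDerivAt_conv j v x).differentiableAt, ?_⟩
  rw [show fderiv ℝ (conv j v) = _ from funext fun x => (hasFDerivAt_conv j v x).fderiv]
  exact continuous_fderiv_conv j v

lemma pd_conv (i j : Fin 2) (v : 𝓢(R2, ℝ)) : pd i (conv j v) = conv j (D i v) := by
  ext x
  have h : Integrable fun z => newton j z • fderiv ℝ v (x - z) :=
    integrable_newton_smul (SchwartzMap.fderivCLM ℝ R2 ℝ v) j x
  rw [pd, (hasFDerivAt_conv j v x).fderiv, ContinuousLinearMap.integral_apply h, conv]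
  simp [D, SchwartzMap.lineDerivOp_apply_eq_fderiv]

lemma norm_perp (x : R2) : ‖perp x‖ = ‖x‖ := by
  rw [EuclideanSpace.norm_eq, EuclideanSpace.norm_eq]
  simp [perp, Fin.sum_univ_two, add_comm]

lemma biotSavart_apply (ω : 𝓢(R2, ℝ)) (x : R2) (j : Fin 2) :
    biotSavart ω x j = (2 * π)⁻¹ * ∫ z, ω (x - z) / ‖z‖ ^ 2 * perp z j := by
  have hp : Continuous perp := by
    refine (PiLp.continuous_toLp 2 _).comp (continuous_pi fun i => ?_)
    fin_cases i
    · simp only [Fin.zero_eta, Matrix.cons_val_zero]; fun_prop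
    · simp only [Fin.mk_one, Matrix.cons_val_one]; fun_prop
  have hInt : Integrable fun z : R2 => (ω (x - z) / ‖z‖ ^ 2) • perp z := by
    obtain ⟨b, hb, hle⟩ := exists_newton_bound ω ‖x‖
    refine hb.mono' (AEStronglyMeasurable.smul
      ((ω.continuous.measurable.comp (by fun_prop)).div (by fun_prop)).aestronglyMeasurable
      hp.aestronglyMeasurable) (Eventually.of_forall fun z => ?_)
    refine le_trans (le_of_eq ?_) (hle x z le_rfl)
    rw [norm_smul, norm_perp, norm_div, norm_pow, norm_norm]
    rcases eq_or_ne ‖z‖ 0 with h | h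
    · simp [h]
    · field_simp
  have h1 : biotSavart ω x = (2 * π)⁻¹ • ∫ z : R2, (ω (x - z) / ‖z‖ ^ 2) • perp z := by
    rw [biotSavart, ← integral_sub_left_eq_self (fun z => (ω (x - z) / ‖z‖ ^ 2) • perp z) _ x]
    simp
  rw [h1, PiLp.smul_apply, smul_eq_mul]
  congr 1
  exact ((EuclideanSpace.proj (𝕜 := ℝ) j).integral_comp_comm hInt).symm

lemma biotSavart_zero (ω : 𝓢(R2, ℝ)) : (fun x => biotSavart ω x 0) = conv 1 ω := by
  ext x
  rw [biotSavart_apply, conv, ← integral_const_mul]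
  congr 1; ext z
  simp only [newton, perp]
  simp
  ring

lemma biotSavart_one (ω : 𝓢(R2, ℝ)) : (fun x => biotSavart ω x 1) = fun x => -conv 0 ω x := by
  ext x
  rw [biotSavart_apply, conv, ← integral_const_mul, ← integral_neg]
  congr 1; ext z
  simp only [newton, perp]
  simp
  ring

lemma contDiff_biotSavart (ω : 𝓢(R2, ℝ)) : ContDiff ℝ 1 (biotSavart ω) := by
  rw [contDiff_euclidean]
  intro i
  fin_cases i
  · exact (biotSavart_zero ω) ▸ contDiff_conv 1 ω
  · exact (biotSavart_one ω) ▸ (contDiff_conv 0 ω).neg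

/-- The truncated convolutions with the Newtonian gradient. -/
def convT (S : ℝ) (j : Fin 2) (v : 𝓢(R2, ℝ)) (x : R2) : ℝ :=
  ∫ z, exp (-(‖z‖ ^ 2 / (4 * S))) * (newton j z * v (x - z))

lemma exp_mul_newton_le {S : ℝ} (hS : 0 < S) (j : Fin 2) (v : 𝓢(R2, ℝ)) (x z : R2) :
    ‖exp (-(‖z‖ ^ 2 / (4 * S))) * (newton j z * v (x - z))‖ ≤ ‖newton j z * v (x - z)‖ := by
  rw [norm_mul, norm_of_nonneg (exp_nonneg _)]
  exact mul_le_of_le_one_left (norm_nonneg _)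
    (exp_le_one_iff.2 (neg_nonpos.2 (by positivity)))

lemma aestronglyMeasurable_convT (S : ℝ) (j : Fin 2) (v : 𝓢(R2, ℝ)) (x : R2) :
    AEStronglyMeasurable
      (fun z => exp (-(‖z‖ ^ 2 / (4 * S))) * (newton j z * v (x - z))) volume :=
  (by fun_prop : Continuous fun z : R2 => exp (-(‖z‖ ^ 2 / (4 * S)))).aestronglyMeasurable.mul
    (integrable_newton_smul v j x).aestronglyMeasurable

lemma tendsto_convT_zero (j : Fin 2) (v : 𝓢(R2, ℝ)) (x : R2) :
    Tendsto (fun S => convT S j v x) (𝓝[>] 0) (𝓝 0) := by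
  have h := tendsto_integral_filter_of_dominated_convergence (μ := volume) (l := 𝓝[>] (0 : ℝ))
    (F := fun S z => exp (-(‖z‖ ^ 2 / (4 * S))) * (newton j z * v (x - z)))
    (f := fun _ => (0 : ℝ)) (fun z => ‖newton j z * v (x - z)‖)
    (Eventually.of_forall fun S => aestronglyMeasurable_convT S j v x) ?_
    (integrable_newton_smul v j x).norm (Eventually.of_forall fun z => ?_)
  · simpa [convT] using h
  · filter_upwards [self_mem_nhdsWithin] with S hS
    exact Eventually.of_forall fun z => exp_mul_newton_le hS j v x z
  · rcases eq_or_ne z 0 with rfl | hz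
    · simp [newton]
    have hz0 : 0 < ‖z‖ ^ 2 / 4 := by positivity
    have h1 : Tendsto (fun S : ℝ => ‖z‖ ^ 2 / (4 * S)) (𝓝[>] 0) atTop := by
      refine (tendsto_inv_nhdsGT_zero.const_mul_atTop hz0).congr fun S => ?_
      rw [← div_eq_mul_inv, div_div]
    simpa using (tendsto_exp_neg_atTop_nhds_zero.comp h1).mul_const (newton j z * v (x - z))

lemma tendsto_convT_atTop (j : Fin 2) (v : 𝓢(R2, ℝ)) (x : R2) :
    Tendsto (fun S => convT S j v x) atTop (𝓝 (conv j v x)) := by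
  refine tendsto_integral_filter_of_dominated_convergence (μ := volume)
    (fun z => ‖newton j z * v (x - z)‖)
    (Eventually.of_forall fun S => aestronglyMeasurable_convT S j v x) ?_
    (integrable_newton_smul v j x).norm (Eventually.of_forall fun z => ?_)
  · filter_upwards [eventually_gt_atTop 0] with S hS
    exact Eventually.of_forall fun z => exp_mul_newton_le hS j v x z
  · have h1 : Tendsto (fun S : ℝ => ‖z‖ ^ 2 / (4 * S)) atTop (𝓝 0) :=
      tendsto_const_nhds.div_atTop (tendsto_id.const_mul_atTop (by norm_num))
    simpa using ((continuous_exp.tendsto _).comp h1.neg).mul_const (newton j z * v (x - z))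

lemma hasDerivAt_convT {S : ℝ} (hS : 0 < S) (j : Fin 2) (v : 𝓢(R2, ℝ)) (x : R2) :
    HasDerivAt (fun S => convT S j v x) (heat S (D j v) x) S := by
  obtain ⟨C, hC0, hC⟩ := exists_decay v
  have hd : ∀ z : R2, ∀ s : ℝ, 0 < s →
      HasDerivAt (fun s => exp (-(‖z‖ ^ 2 / (4 * s))) * (newton j z * v (x - z)))
        (-(8 * π * s ^ 2)⁻¹ * (z j * exp (-(‖z‖ ^ 2 / (4 * s))) * v (x - z))) s := by
    intro z s hs
    have h1 : HasDerivAt (fun s : ℝ => -(‖z‖ ^ 2 / (4 * s))) (‖z‖ ^ 2 / (4 * s ^ 2)) s := by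
      have := ((hasDerivAt_inv hs.ne').const_mul (‖z‖ ^ 2 / 4)).neg
      refine (this.congr_of_eventuallyEq (Eventually.of_forall fun r => ?_)).congr_deriv ?_
      · simp only [Pi.neg_apply, ← div_eq_mul_inv, div_div]
      · field_simp
    refine (h1.exp.mul_const (newton j z * v (x - z))).congr_deriv ?_
    rcases eq_or_ne z 0 with rfl | hz
    · simp
    have hz0 : ‖z‖ ≠ 0 := norm_ne_zero_iff.2 hz
    rw [newton]
    field_simp
    ring
  have key := hasDerivAt_integral_of_dominated_loc_of_deriv_le (μ := volume) (s := Set.Ioi (S / 2))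
    (F := fun s z => exp (-(‖z‖ ^ 2 / (4 * s))) * (newton j z * v (x - z)))
    (F' := fun s z => -(8 * π * s ^ 2)⁻¹ * (z j * exp (-(‖z‖ ^ 2 / (4 * s))) * v (x - z)))
    (x₀ := S) (bound := fun z => (8 * π * (S / 2) ^ 2)⁻¹ * (C * (1 + ‖x‖) ^ 4) *
      (‖z‖ * ((1 + ‖z‖) ^ 4)⁻¹)) (Ioi_mem_nhds (by linarith))
    (Eventually.of_forall fun s => aestronglyMeasurable_convT s j v x)
    ((integrable_newton_smul v j x).mono (aestronglyMeasurable_convT S j v x)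
      (Eventually.of_forall fun z => exp_mul_newton_le hS j v x z))
    ((continuous_const.mul ((by fun_prop : Continuous fun z : R2 =>
      z j * exp (-(‖z‖ ^ 2 / (4 * S)))).mul
        (v.continuous.comp (by fun_prop)))).aestronglyMeasurable)
    (Eventually.of_forall fun z s hs => ?_) (integrable_norm_mul.const_mul _)
    (Eventually.of_forall fun z s hs => hd z s (lt_trans (by positivity) hs))
  · refine key.2.congr_deriv ?_
    have hsq : 0 < √S := by positivity
    have h1 := Measure.integral_comp_smul (volume : Measure R2)
      (fun z => z j * exp (-(‖z‖ ^ 2 / (4 * S))) * v (x - z)) (√S)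
    have h2 := integral_coord_gauss_mul j S v x
    have h3 : ∫ w : R2, (√S • w) j * exp (-(‖√S • w‖ ^ 2 / (4 * S))) * v (x - √S • w) =
        4 * π * √S * ∫ w : R2, w j * gauss w * v (x - √S • w) := by
      rw [← integral_const_mul]
      congr 1; ext w
      rw [norm_smul, mul_pow, norm_of_nonneg hsq.le, sq_sqrt hS.le, gauss,
        show -(S * ‖w‖ ^ 2 / (4 * S)) = -(1 / 4) * ‖w‖ ^ 2 by field_simp]
      simp
      field_simp
    rw [h3, h2] at h1
    simp only [finrank_euclideanSpace, Fintype.card_fin, sq_sqrt hS.le, smul_eq_mul,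
      abs_of_pos (inv_pos.2 hS)] at h1
    rw [integral_const_mul]
    have h4 : ∫ z : R2, z j * exp (-(‖z‖ ^ 2 / (4 * S))) * v (x - z) =
        S * (4 * π * √S * (-(2 * √S) * heat S (D j v) x)) := by
      rw [h1]; field_simp
    rw [h4]
    have h5 : √S * √S = S := mul_self_sqrt hS.le
    field_simp
    rw [sq_sqrt hS.le]
    ring
  · have hs0 : 0 < s := lt_trans (by positivity) hs
    have hs2 : S / 2 ≤ s := le_of_lt hs
    rw [norm_mul, norm_neg, norm_of_nonneg (by positivity), norm_mul, norm_mul,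
      norm_of_nonneg (exp_nonneg _), mul_assoc (8 * π * (S / 2) ^ 2)⁻¹]
    have h1 : exp (-(‖z‖ ^ 2 / (4 * s))) ≤ 1 :=
      exp_le_one_iff.2 (neg_nonpos.2 (by positivity))
    calc (8 * π * s ^ 2)⁻¹ * (‖z j‖ * exp (-(‖z‖ ^ 2 / (4 * s))) * ‖v (x - z)‖)
        ≤ (8 * π * (S / 2) ^ 2)⁻¹ * (‖z‖ * 1 * (C * (1 + ‖x‖) ^ 4 * ((1 + ‖z‖) ^ 4)⁻¹)) := by
          gcongr
          · exact abs_coord_le z j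
          · exact hC x z
      _ = _ := by ring

lemma intervalIntegrable_heat (S T : ℝ) (f : 𝓢(R2, ℝ)) (x : R2) :
    IntervalIntegrable (fun t => heat t f x) volume S T :=
  ((continuous_heat f).comp (continuous_id.prodMk continuous_const)).intervalIntegrable S T

lemma integral_heat_eq_convT {S : ℝ} (hS : 0 < S) (j : Fin 2) (v : 𝓢(R2, ℝ)) (x : R2) :
    ∫ t in 0..S, heat t (D j v) x = convT S j v x := by
  rw [intervalIntegral.integral_eq_sub_of_hasDerivAt_of_tendsto hS
    (fun t ht => hasDerivAt_convT ht.1 j v x) (intervalIntegrable_heat _ _ _ _)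
    (tendsto_convT_zero j v x)
    ((hasDerivAt_convT hS j v x).continuousAt.tendsto.mono_left nhdsWithin_le_nhds), sub_zero]

lemma tendsto_integral_heat (j : Fin 2) (v : 𝓢(R2, ℝ)) (x : R2) :
    Tendsto (fun S => ∫ t in 0..S, heat t (D j v) x) atTop (𝓝 (conv j v x)) := by
  refine (tendsto_convT_atTop j v x).congr' ?_
  filter_upwards [eventually_gt_atTop 0] with S hS
  exact (integral_heat_eq_convT hS j v x).symm

lemma integral_heat_laplacian {S : ℝ} (hS : 0 < S) (f : 𝓢(R2, ℝ)) (x : R2) :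
    ∑ i, ∫ t in 0..S, heat t (D i (D i f)) x = heat S f x - f x := by
  rw [← intervalIntegral.integral_finsetSum fun i _ => intervalIntegrable_heat _ _ _ _,
    intervalIntegral.integral_eq_sub_of_hasDerivAt_of_le hS.le
    ((continuous_heat f).comp (continuous_id.prodMk continuous_const)).continuousOn
    (fun t ht => heat_hasDerivAt ht.1 f x)]
  · simp [heat_zero]
  · exact (continuous_finsetSum _ fun i _ => (continuous_heat (D i (D i f))).comp
      (continuous_id.prodMk continuous_const)).intervalIntegrable _ _

lemma sum_conv (f : 𝓢(R2, ℝ)) (x : R2) : ∑ i, conv i (D i f) x = -f x := by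
  have h1 : Tendsto (fun S => heat S f x - f x) atTop (𝓝 (0 - f x)) := by
    refine Tendsto.sub_const (squeeze_zero_norm' (a := fun t => (4 * π)⁻¹ * (t⁻¹ * ∫ z, |f z|))
      ?_ ?_) _
    · filter_upwards [eventually_gt_atTop 0] with t ht
      exact abs_heat_le_div ht f x
    · simpa using (tendsto_inv_atTop_zero.mul_const (∫ z, |f z|)).const_mul (4 * π)⁻¹
  have h2 : Tendsto (fun S => heat S f x - f x) atTop (𝓝 (∑ i, conv i (D i f) x)) := by
    refine (tendsto_finsetSum _ fun i _ => tendsto_integral_heat i (D i f) x).congr' ?_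
    filter_upwards [eventually_gt_atTop 0] with S hS
    exact integral_heat_laplacian hS f x
  simpa using tendsto_nhds_unique h2 h1

lemma conv_D_comm (i j : Fin 2) (f : 𝓢(R2, ℝ)) (x : R2) :
    conv j (D i f) x = conv i (D j f) x := by
  refine tendsto_nhds_unique (tendsto_integral_heat j (D i f) x) ?_
  rw [D_comm]
  exact tendsto_integral_heat i (D j f) x

lemma pd_biotSavart_zero (i : Fin 2) (ω : 𝓢(R2, ℝ)) :
    pd i (fun x => biotSavart ω x 0) = conv 1 (D i ω) := by
  rw [biotSavart_zero, pd_conv]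

lemma pd_biotSavart_one (i : Fin 2) (ω : 𝓢(R2, ℝ)) :
    pd i (fun x => biotSavart ω x 1) = -conv 0 (D i ω) := by
  rw [biotSavart_one, ← pd_conv]
  ext x
  rw [pd, Pi.neg_apply, pd, fderiv_fun_neg]
  rfl

lemma biotSavart_div_curl (ω : 𝓢(R2, ℝ)) (x : R2) :
    pd 0 (fun y => biotSavart ω y 0) x + pd 1 (fun y => biotSavart ω y 1) x = 0 ∧
    pd 0 (fun y => biotSavart ω y 1) x - pd 1 (fun y => biotSavart ω y 0) x = ω x := by
  rw [pd_biotSavart_zero, pd_biotSavart_zero, pd_biotSavart_one, pd_biotSavart_one,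
    Pi.neg_apply, Pi.neg_apply]
  have h := sum_conv ω x
  rw [Fin.sum_univ_two] at h
  exact ⟨by rw [conv_D_comm 0 1]; ring, by linarith⟩

section Bellman

variable (b k δ ε : ℝ)

/-- The inner argument of the Bellman function. -/
def bellW (x y : ℝ) : ℝ := (x ^ 2 + ε ^ 2) + (y ^ 2 + ε ^ 2) ^ k

/-- A regularised Nazarov–Treil type Bellman function. -/
def bell (x y : ℝ) : ℝ :=
  (x ^ 2 + ε ^ 2) ^ (1 - b) - (ε ^ 2) ^ (1 - b) + δ * (y ^ 2 * bellW k ε x y ^ b)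

/-- The partial derivative `∂ₓ` of the Bellman function. -/
def bellX (x y : ℝ) : ℝ :=
  2 * (1 - b) * (x * (x ^ 2 + ε ^ 2) ^ (-b)) + δ * (2 * b * (x * (y ^ 2 * bellW k ε x y ^ (b - 1))))

/-- The partial derivative `∂_y` of the Bellman function. -/
def bellY (x y : ℝ) : ℝ :=
  δ * (2 * (y * bellW k ε x y ^ b) +
    2 * b * k * (y ^ 3 * (bellW k ε x y ^ (b - 1) * (y ^ 2 + ε ^ 2) ^ (k - 1))))

/-- The second partial derivative `∂ₓ∂ₓ` of the Bellman function. -/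
def bellXX (x y : ℝ) : ℝ :=
  2 * (1 - b) * ((x ^ 2 + ε ^ 2) ^ (-b) - 2 * b * x ^ 2 * (x ^ 2 + ε ^ 2) ^ (-b - 1)) +
    δ * (2 * b * y ^ 2 * (bellW k ε x y ^ (b - 1) -
      2 * (1 - b) * x ^ 2 * bellW k ε x y ^ (b - 1 - 1)))

/-- The mixed partial derivative of the Bellman function. -/
def bellXY (x y : ℝ) : ℝ :=
  δ * (4 * b * (x * y) * bellW k ε x y ^ (b - 1) -
    4 * b * k * (1 - b) * (x * y ^ 3) *
      (bellW k ε x y ^ (b - 1 - 1) * (y ^ 2 + ε ^ 2) ^ (k - 1)))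

/-- The second partial derivative `∂_y∂_y` of the Bellman function. -/
def bellYY (x y : ℝ) : ℝ :=
  δ * (2 * bellW k ε x y ^ b +
    10 * b * k * y ^ 2 * (bellW k ε x y ^ (b - 1) * (y ^ 2 + ε ^ 2) ^ (k - 1)) +
    4 * b * k * (k - 1) * y ^ 4 * (bellW k ε x y ^ (b - 1) * (y ^ 2 + ε ^ 2) ^ (k - 1 - 1)) -
    4 * b * (1 - b) * k ^ 2 * y ^ 4 *
      (bellW k ε x y ^ (b - 1 - 1) * ((y ^ 2 + ε ^ 2) ^ (k - 1)) ^ 2))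

variable {b k δ ε}

lemma sq_add_sq_pos (hε : 0 < ε) (x : ℝ) : 0 < x ^ 2 + ε ^ 2 := by positivity

lemma bellW_pos (hε : 0 < ε) (x y : ℝ) : 0 < bellW k ε x y :=
  add_pos (sq_add_sq_pos hε x) (rpow_pos_of_pos (sq_add_sq_pos hε y) k)

section Deriv

variable {u v : ℝ → ℝ} {u' v' t : ℝ}

lemma hasDerivAt_sq_add_rpow (hε : 0 < ε) (r : ℝ) (hu : HasDerivAt u u' t) :
    HasDerivAt (fun t => (u t ^ 2 + ε ^ 2) ^ r)
      (2 * r * u t * (u t ^ 2 + ε ^ 2) ^ (r - 1) * u') t := by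
  refine (((hu.fun_pow 2).add_const (ε ^ 2)).rpow_const (p := r)
    (Or.inl (sq_add_sq_pos hε _).ne')).congr_deriv ?_
  simp; ring

lemma hasDerivAt_bellW_rpow (hε : 0 < ε) (r : ℝ) (hu : HasDerivAt u u' t)
    (hv : HasDerivAt v v' t) :
    HasDerivAt (fun t => bellW k ε (u t) (v t) ^ r)
      (r * bellW k ε (u t) (v t) ^ (r - 1) *
        (2 * u t * u' + 2 * k * v t * (v t ^ 2 + ε ^ 2) ^ (k - 1) * v')) t := by
  have h : HasDerivAt (fun t => bellW k ε (u t) (v t))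
      (2 * u t * u' + 2 * k * v t * (v t ^ 2 + ε ^ 2) ^ (k - 1) * v') t := by
    refine (((hu.fun_pow 2).add_const (ε ^ 2)).add
      (hasDerivAt_sq_add_rpow hε k hv)).congr_deriv ?_
    simp
  refine (h.rpow_const (p := r) (Or.inl (bellW_pos hε _ _).ne')).congr_deriv ?_
  ring

lemma hasDerivAt_bell (hε : 0 < ε) (hu : HasDerivAt u u' t) (hv : HasDerivAt v v' t) :
    HasDerivAt (fun t => bell b k δ ε (u t) (v t))
      (bellX b k δ ε (u t) (v t) * u' + bellY b k δ ε (u t) (v t) * v') t := by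
  refine (((hasDerivAt_sq_add_rpow hε (1 - b) hu).sub_const _).add
    (((hv.fun_pow 2).mul (hasDerivAt_bellW_rpow (k := k) hε b hu hv)).const_mul δ)).congr_deriv ?_
  rw [bellX, bellY, show 1 - b - 1 = -b by ring]
  simp; ring

lemma hasDerivAt_bellX (hε : 0 < ε) (hu : HasDerivAt u u' t) (hv : HasDerivAt v v' t) :
    HasDerivAt (fun t => bellX b k δ ε (u t) (v t))
      (bellXX b k δ ε (u t) (v t) * u' + bellXY b k δ ε (u t) (v t) * v') t := by
  refine (((hu.mul (hasDerivAt_sq_add_rpow hε (-b) hu)).const_mul (2 * (1 - b))).add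
    (((hu.mul ((hv.fun_pow 2).mul (hasDerivAt_bellW_rpow (k := k) hε (b - 1) hu hv))).const_mul
      (2 * b)).const_mul δ)).congr_deriv ?_
  rw [bellXX, bellXY]
  simp; ring

lemma hasDerivAt_bellY (hε : 0 < ε) (hu : HasDerivAt u u' t) (hv : HasDerivAt v v' t) :
    HasDerivAt (fun t => bellY b k δ ε (u t) (v t))
      (bellXY b k δ ε (u t) (v t) * u' + bellYY b k δ ε (u t) (v t) * v') t := by
  refine ((((hv.mul (hasDerivAt_bellW_rpow (k := k) hε b hu hv)).const_mul 2).add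
    (((hv.fun_pow 3).mul ((hasDerivAt_bellW_rpow (k := k) hε (b - 1) hu hv).mul
      (hasDerivAt_sq_add_rpow hε (k - 1) hv))).const_mul (2 * b * k))).const_mul δ).congr_deriv ?_
  rw [bellXY, bellYY]
  simp; ring

end Deriv

lemma continuous_sq_add_rpow {X : Type*} [TopologicalSpace X] (hε : 0 < ε) (r : ℝ) {u : X → ℝ}
    (hu : Continuous u) : Continuous fun x => (u x ^ 2 + ε ^ 2) ^ r :=
  ((hu.pow 2).add continuous_const).rpow_const fun _ => Or.inl (sq_add_sq_pos hε _).ne'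

lemma continuous_bellW_rpow (hε : 0 < ε) (r : ℝ) :
    Continuous fun q : ℝ × ℝ => bellW k ε q.1 q.2 ^ r :=
  (((continuous_fst.pow 2).add continuous_const).add
    (continuous_sq_add_rpow hε k continuous_snd)).rpow_const
      fun _ => Or.inl (bellW_pos hε _ _).ne'

lemma continuous_bell (hε : 0 < ε) : Continuous fun q : ℝ × ℝ => bell b k δ ε q.1 q.2 := by
  have h1 := continuous_sq_add_rpow hε (1 - b) (continuous_fst (X := ℝ) (Y := ℝ))
  have h2 := continuous_bellW_rpow (k := k) hε b
  unfold bell; fun_prop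

lemma continuous_bellX (hε : 0 < ε) : Continuous fun q : ℝ × ℝ => bellX b k δ ε q.1 q.2 := by
  have h1 := continuous_sq_add_rpow hε (-b) (continuous_fst (X := ℝ) (Y := ℝ))
  have h2 := continuous_bellW_rpow (k := k) hε (b - 1)
  unfold bellX; fun_prop

lemma continuous_bellY (hε : 0 < ε) : Continuous fun q : ℝ × ℝ => bellY b k δ ε q.1 q.2 := by
  have h1 := continuous_sq_add_rpow hε (k - 1) (continuous_snd (X := ℝ) (Y := ℝ))
  have h2 := continuous_bellW_rpow (k := k) hε (b - 1)
  have h3 := continuous_bellW_rpow (k := k) hε b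
  unfold bellY; fun_prop

lemma continuous_bellXX (hε : 0 < ε) : Continuous fun q : ℝ × ℝ => bellXX b k δ ε q.1 q.2 := by
  have h1 := continuous_sq_add_rpow hε (-b) (continuous_fst (X := ℝ) (Y := ℝ))
  have h2 := continuous_bellW_rpow (k := k) hε (b - 1)
  have h3 := continuous_bellW_rpow (k := k) hε (b - 1 - 1)
  have h4 := continuous_sq_add_rpow hε (-b - 1) (continuous_fst (X := ℝ) (Y := ℝ))
  unfold bellXX; fun_prop

lemma continuous_bellXY (hε : 0 < ε) : Continuous fun q : ℝ × ℝ => bellXY b k δ ε q.1 q.2 := by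
  have h1 := continuous_sq_add_rpow hε (k - 1) (continuous_snd (X := ℝ) (Y := ℝ))
  have h2 := continuous_bellW_rpow (k := k) hε (b - 1)
  have h3 := continuous_bellW_rpow (k := k) hε (b - 1 - 1)
  unfold bellXY; fun_prop

lemma continuous_bellYY (hε : 0 < ε) : Continuous fun q : ℝ × ℝ => bellYY b k δ ε q.1 q.2 := by
  have h0 := continuous_bellW_rpow (k := k) hε b
  have h1 := continuous_sq_add_rpow hε (k - 1) (continuous_snd (X := ℝ) (Y := ℝ))
  have h2 := continuous_bellW_rpow (k := k) hε (b - 1)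
  have h3 := continuous_bellW_rpow (k := k) hε (b - 1 - 1)
  have h4 := continuous_sq_add_rpow hε (k - 1 - 1) (continuous_snd (X := ℝ) (Y := ℝ))
  unfold bellYY; fun_prop

end Bellman

section BellmanEstimates

variable {b k δ ε : ℝ}

lemma sq_add_sq_le_bellW (hε : 0 < ε) (x y : ℝ) : x ^ 2 + ε ^ 2 ≤ bellW k ε x y :=
  le_add_of_nonneg_right (rpow_nonneg (sq_add_sq_pos hε y).le k)

lemma sq_le_bellW_rpow (hε : 0 < ε) (hb : b < 1 / 2) (hk : k * (1 - 2 * b) = 1) (x y : ℝ) :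
    y ^ 2 ≤ bellW k ε x y ^ (1 - 2 * b) := by
  have hτ := sq_add_sq_pos hε y
  calc y ^ 2 ≤ y ^ 2 + ε ^ 2 := by nlinarith
    _ = ((y ^ 2 + ε ^ 2) ^ k) ^ (1 - 2 * b) := by rw [← rpow_mul hτ.le, hk, rpow_one]
    _ ≤ _ := rpow_le_rpow (rpow_nonneg hτ.le _)
      (le_add_of_nonneg_left (sq_add_sq_pos hε x).le) (by linarith)

lemma abs_mul_le_bellW_rpow (hε : 0 < ε) (hb : b < 1 / 2) (hk : k * (1 - 2 * b) = 1)
    (x y : ℝ) : |x * y| ≤ bellW k ε x y ^ (1 - b) := by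
  have hW := bellW_pos (k := k) hε x y
  refine abs_le_of_sq_le_sq ?_ (rpow_nonneg hW.le _)
  have h1 : x ^ 2 ≤ bellW k ε x y :=
    le_trans (by nlinarith) (sq_add_sq_le_bellW (k := k) hε x y)
  calc (x * y) ^ 2 = x ^ 2 * y ^ 2 := by ring
    _ ≤ bellW k ε x y * bellW k ε x y ^ (1 - 2 * b) := by
        gcongr; exact sq_le_bellW_rpow hε hb hk x y
    _ = _ := by
        rw [← rpow_natCast (bellW k ε x y ^ (1 - b)), ← rpow_mul hW.le, ← rpow_one_add' hW.le]
        · congr 1; push_cast; ring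
        · linarith

lemma sq_mul_rpow_le_bellW (hε : 0 < ε) (x y : ℝ) :
    (y ^ 2 + ε ^ 2) * (y ^ 2 + ε ^ 2) ^ (k - 1) ≤ bellW k ε x y := by
  have hτ := sq_add_sq_pos hε y
  rw [rpow_sub_one hτ.ne', mul_div_cancel₀ _ hτ.ne']
  exact le_add_of_nonneg_left (sq_add_sq_pos hε x).le

lemma le_bellXX (hε : 0 < ε) (hδ : 0 < δ) (hb0 : 0 < b) (hb : b < 1 / 2)
    (hk : k * (1 - 2 * b) = 1) (x y : ℝ) :
    (2 * ((1 - b) * (1 - 2 * b)) - δ * (2 * b)) * (x ^ 2 + ε ^ 2) ^ (-b) ≤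
      bellXX b k δ ε x y := by
  have hs := sq_add_sq_pos hε x
  have hW := bellW_pos (k := k) hε x y
  have hsW := sq_add_sq_le_bellW (k := k) hε x y
  have h1 : x ^ 2 * (x ^ 2 + ε ^ 2) ^ (-b - 1) ≤ (x ^ 2 + ε ^ 2) ^ (-b) := by
    rw [rpow_sub_one hs.ne', ← mul_div_assoc, div_le_iff₀ hs, mul_comm]
    gcongr; nlinarith
  have h2 : y ^ 2 * bellW k ε x y ^ (b - 1) ≤ (x ^ 2 + ε ^ 2) ^ (-b) := by
    calc y ^ 2 * bellW k ε x y ^ (b - 1)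
        ≤ bellW k ε x y ^ (1 - 2 * b) * bellW k ε x y ^ (b - 1) := by
          gcongr; exact sq_le_bellW_rpow hε hb hk x y
      _ = bellW k ε x y ^ (-b) := by rw [← rpow_add hW]; congr 1; ring
      _ ≤ _ := rpow_le_rpow_of_nonpos hs hsW (by linarith)
  have h3 : x ^ 2 * bellW k ε x y ^ (b - 1 - 1) ≤ bellW k ε x y ^ (b - 1) := by
    rw [rpow_sub_one hW.ne', ← mul_div_assoc, div_le_iff₀ hW, mul_comm]
    gcongr; nlinarith
  have h4 : -bellW k ε x y ^ (b - 1) ≤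
      bellW k ε x y ^ (b - 1) - 2 * (1 - b) * x ^ 2 * bellW k ε x y ^ (b - 1 - 1) := by
    have := mul_le_mul_of_nonneg_left h3 (by linarith : 0 ≤ 2 * (1 - b))
    have h5 : 0 ≤ b * bellW k ε x y ^ (b - 1) := by positivity
    linarith
  have h6 := mul_le_mul_of_nonneg_left h4 (by positivity : 0 ≤ 2 * b * y ^ 2)
  have h7 := mul_le_mul_of_nonneg_left h2 (by positivity : 0 ≤ 2 * b)
  have h8 : -(2 * b * (x ^ 2 + ε ^ 2) ^ (-b)) ≤ 2 * b * y ^ 2 * (bellW k ε x y ^ (b - 1) -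
      2 * (1 - b) * x ^ 2 * bellW k ε x y ^ (b - 1 - 1)) := by linarith
  have h9 := mul_le_mul_of_nonneg_left h8 hδ.le
  have h10 := mul_le_mul_of_nonneg_left h1
    (mul_nonneg (by linarith) (by linarith) : 0 ≤ 2 * (1 - b) * (2 * b))
  rw [bellXX]
  linarith

lemma abs_bellXY_le (hε : 0 < ε) (hδ : 0 < δ) (hb0 : 0 < b) (hb : b < 1 / 2) (hk0 : 0 < k)
    (hk : k * (1 - 2 * b) = 1) (x y : ℝ) :
    |bellXY b k δ ε x y| ≤ δ * (4 * b + 4 * b * k * (1 - b)) := by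
  have hτ := sq_add_sq_pos hε y
  have hW := bellW_pos (k := k) hε x y
  have hb1 : 0 < 1 - b := by linarith
  have h1 : |x * y| * bellW k ε x y ^ (b - 1) ≤ 1 := by
    calc |x * y| * bellW k ε x y ^ (b - 1)
        ≤ bellW k ε x y ^ (1 - b) * bellW k ε x y ^ (b - 1) := by
          gcongr; exact abs_mul_le_bellW_rpow hε hb hk x y
      _ = 1 := by rw [← rpow_add hW]; simp
  have h2 : y ^ 2 * (y ^ 2 + ε ^ 2) ^ (k - 1) / bellW k ε x y ≤ 1 := by
    rw [div_le_one hW]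
    refine le_trans ?_ (sq_mul_rpow_le_bellW hε x y)
    gcongr; nlinarith
  have h3 : |x * y ^ 3| * (bellW k ε x y ^ (b - 1 - 1) * (y ^ 2 + ε ^ 2) ^ (k - 1)) ≤ 1 := by
    calc |x * y ^ 3| * (bellW k ε x y ^ (b - 1 - 1) * (y ^ 2 + ε ^ 2) ^ (k - 1))
        = |x * y| * bellW k ε x y ^ (b - 1) *
          (y ^ 2 * (y ^ 2 + ε ^ 2) ^ (k - 1) / bellW k ε x y) := by
          rw [rpow_sub_one hW.ne', show x * y ^ 3 = x * y * y ^ 2 by ring, abs_mul (x * y),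
            abs_of_nonneg (sq_nonneg y)]
          ring
      _ ≤ 1 * 1 := by gcongr
      _ = 1 := one_mul 1
  rw [bellXY, abs_mul, abs_of_pos hδ]
  gcongr
  refine (abs_sub _ _).trans (add_le_add ?_ ?_)
  · rw [abs_mul, abs_mul, abs_of_pos (by positivity : 0 < 4 * b),
      abs_of_pos (rpow_pos_of_pos hW _), mul_assoc]
    exact mul_le_of_le_one_right (by positivity) h1
  · rw [abs_mul, abs_mul, abs_of_pos (by positivity : 0 < 4 * b * k * (1 - b)),
      abs_of_pos (mul_pos (rpow_pos_of_pos hW _) (rpow_pos_of_pos hτ _)), mul_assoc]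
    exact mul_le_of_le_one_right (by positivity) h3

lemma le_bellYY (hε : 0 < ε) (hδ : 0 < δ) (hb0 : 0 < b) (hb : b < 1 / 2) (hk1 : 1 < k)
    (x y : ℝ) : 2 * δ * (x ^ 2 + ε ^ 2) ^ b ≤ bellYY b k δ ε x y := by
  have hs := sq_add_sq_pos hε x
  have hτ := sq_add_sq_pos hε y
  have hW := bellW_pos (k := k) hε x y
  have h1 : (x ^ 2 + ε ^ 2) ^ b ≤ bellW k ε x y ^ b :=
    rpow_le_rpow hs.le (sq_add_sq_le_bellW hε x y) hb0.le
  have hρ : y ^ 4 / (y ^ 2 + ε ^ 2) ≤ y ^ 2 := by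
    rw [div_le_iff₀ hτ]; nlinarith [mul_nonneg (sq_nonneg y) (sq_nonneg ε)]
  have hT : (y ^ 2 + ε ^ 2) ^ (k - 1) / bellW k ε x y ≤ 1 / (y ^ 2 + ε ^ 2) := by
    rw [div_le_div_iff₀ hW hτ, one_mul, mul_comm]
    exact sq_mul_rpow_le_bellW hε x y
  have h2 : 0 ≤ 10 * y ^ 2 + 4 * (k - 1) * (y ^ 4 / (y ^ 2 + ε ^ 2)) -
      4 * (1 - b) * k * y ^ 4 * ((y ^ 2 + ε ^ 2) ^ (k - 1) / bellW k ε x y) := by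
    have h3 := mul_le_mul_of_nonneg_left hT
      (by have : 0 < 1 - b := by linarith
          positivity : 0 ≤ 4 * (1 - b) * k * y ^ 4)
    have h4 : 0 ≤ y ^ 4 / (y ^ 2 + ε ^ 2) := by positivity
    have h5 : 0 ≤ b * k * (y ^ 4 / (y ^ 2 + ε ^ 2)) := by positivity
    have h6 : 4 * (1 - b) * k * y ^ 4 * (1 / (y ^ 2 + ε ^ 2)) =
      4 * k * (y ^ 4 / (y ^ 2 + ε ^ 2)) - 4 * (b * k * (y ^ 4 / (y ^ 2 + ε ^ 2))) := by ring
    nlinarith [sq_nonneg y]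
  have h7 : bellYY b k δ ε x y = δ * (2 * bellW k ε x y ^ b +
      b * k * (bellW k ε x y ^ (b - 1) * (y ^ 2 + ε ^ 2) ^ (k - 1)) *
      (10 * y ^ 2 + 4 * (k - 1) * (y ^ 4 / (y ^ 2 + ε ^ 2)) -
      4 * (1 - b) * k * y ^ 4 * ((y ^ 2 + ε ^ 2) ^ (k - 1) / bellW k ε x y))) := by
    rw [bellYY, rpow_sub_one hW.ne' (b - 1), rpow_sub_one hτ.ne' (k - 1)]
    ring
  rw [h7, mul_comm 2 δ, mul_assoc]
  gcongr
  refine le_add_of_le_of_nonneg (by linarith) (mul_nonneg ?_ h2)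
  positivity

lemma bellman_hessian_ge (hε : 0 < ε) (hδ : 0 < δ) (hb0 : 0 < b) (hb : b < 1 / 2) (hk1 : 1 < k)
    (hk : k * (1 - 2 * b) = 1) (hδ1 : δ ≤ (1 - b) * (1 - 2 * b))
    (hδ2 : δ * (2 * b + (4 * b + 4 * b * k * (1 - b)) ^ 2) ≤ (1 - b) * (1 - 2 * b))
    (x y a c : ℝ) :
    δ * ((x ^ 2 + ε ^ 2) ^ (-b) * a ^ 2 + (x ^ 2 + ε ^ 2) ^ b * c ^ 2) ≤
      bellXX b k δ ε x y * a ^ 2 + 2 * bellXY b k δ ε x y * (a * c) +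
        bellYY b k δ ε x y * c ^ 2 := by
  have hs := sq_add_sq_pos hε x
  have h1 := mul_le_mul_of_nonneg_right (le_bellXX hε hδ hb0 hb hk x y) (sq_nonneg a)
  have h2 := mul_le_mul_of_nonneg_right (le_bellYY (k := k) hε hδ hb0 hb hk1 x y) (sq_nonneg c)
  have h3 := abs_bellXY_le hε hδ hb0 hb (by linarith) hk x y
  set C := 4 * b + 4 * b * k * (1 - b)
  set m := (1 - b) * (1 - 2 * b)
  set X := (x ^ 2 + ε ^ 2) ^ (-b) * a ^ 2 with hX
  set Y := (x ^ 2 + ε ^ 2) ^ b * c ^ 2 with hY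
  have hX0 : 0 ≤ X := by positivity
  have hY0 : 0 ≤ Y := by positivity
  have hC0 : 0 ≤ C := by
    have : 0 < 1 - b := by linarith
    have : 0 < k := by linarith
    positivity
  have hXY : X * Y = (a * c) ^ 2 := by
    rw [hX, hY, rpow_neg hs.le]
    have := (rpow_pos_of_pos hs b).ne'
    field_simp
  have h4 : 2 * C * |a * c| ≤ C ^ 2 * X + Y := by
    refine abs_le_of_sq_le_sq' ?_ (by positivity) |>.2
    rw [mul_pow, sq_abs, ← hXY]
    nlinarith [sq_nonneg (C ^ 2 * X - Y)]
  have h5 : -(2 * (δ * C) * |a * c|) ≤ 2 * bellXY b k δ ε x y * (a * c) := by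
    have h6 : |bellXY b k δ ε x y * (a * c)| ≤ δ * C * |a * c| := by
      rw [abs_mul]; gcongr
    linarith [neg_abs_le (bellXY b k δ ε x y * (a * c))]
  have h7 := mul_le_mul_of_nonneg_left h4 hδ.le
  have h8 := mul_le_mul_of_nonneg_right hδ2 hX0
  have h9 := mul_le_mul_of_nonneg_right hδ1 hX0
  have h10 : (2 * m - δ * (2 * b)) * X ≤ bellXX b k δ ε x y * a ^ 2 := by
    rw [hX]; linarith
  have h11 : 2 * δ * Y ≤ bellYY b k δ ε x y * c ^ 2 := by rw [hY]; linarith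
  linarith

lemma bellman_hessian_sum_ge (hε : 0 < ε) (hδ : 0 < δ) (hb0 : 0 < b) (hb : b < 1 / 2)
    (hk1 : 1 < k) (hk : k * (1 - 2 * b) = 1) (hδ1 : δ ≤ (1 - b) * (1 - 2 * b))
    (hδ2 : δ * (2 * b + (4 * b + 4 * b * k * (1 - b)) ^ 2) ≤ (1 - b) * (1 - 2 * b))
    (x y : ℝ) (a c : Fin 2 → ℝ) (i j : Fin 2) :
    2 * δ * |a i * c j| ≤ ∑ l, (bellXX b k δ ε x y * a l ^ 2 +
      2 * bellXY b k δ ε x y * (a l * c l) + bellYY b k δ ε x y * c l ^ 2) := by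
  have hs := sq_add_sq_pos hε x
  refine le_trans ?_ (Finset.sum_le_sum fun l _ =>
    bellman_hessian_ge hε hδ hb0 hb hk1 hk hδ1 hδ2 x y (a l) (c l))
  rw [← Finset.mul_sum, mul_comm 2 δ, mul_assoc, Finset.sum_add_distrib]
  gcongr
  have h1 := Finset.single_le_sum (f := fun l => (x ^ 2 + ε ^ 2) ^ (-b) * a l ^ 2)
    (fun l _ => by positivity) (Finset.mem_univ i)
  have h2 := Finset.single_le_sum (f := fun l => (x ^ 2 + ε ^ 2) ^ b * c l ^ 2)
    (fun l _ => by positivity) (Finset.mem_univ j)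
  refine le_trans ?_ (add_le_add h1 h2)
  refine abs_le_of_sq_le_sq' ?_ (by positivity) |>.2
  have hXY : ((x ^ 2 + ε ^ 2) ^ (-b) * a i ^ 2) * ((x ^ 2 + ε ^ 2) ^ b * c j ^ 2) =
      (a i * c j) ^ 2 := by
    rw [rpow_neg hs.le]
    have := (rpow_pos_of_pos hs b).ne'
    field_simp
  rw [mul_pow, sq_abs, ← hXY]
  nlinarith [sq_nonneg (((x ^ 2 + ε ^ 2) ^ (-b) * a i ^ 2) - ((x ^ 2 + ε ^ 2) ^ b * c j ^ 2))]

lemma bell_nonneg (hε : 0 < ε) (hδ : 0 < δ) (hb : b < 1 / 2) (x y : ℝ) :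
    0 ≤ bell b k δ ε x y := by
  have h := rpow_le_rpow (sq_nonneg ε) (le_add_of_nonneg_left (sq_nonneg x) : ε ^ 2 ≤ x ^ 2 + ε ^ 2)
    (by linarith : 0 ≤ 1 - b)
  have := rpow_nonneg (bellW_pos (k := k) hε x y).le b
  rw [bell]
  have : 0 ≤ δ * (y ^ 2 * bellW k ε x y ^ b) := by positivity
  linarith

lemma sq_rpow_eq (x r : ℝ) : (x ^ 2) ^ r = |x| ^ (2 * r) := by
  rw [← sq_abs, ← rpow_natCast, ← rpow_mul (abs_nonneg x)]; norm_num

lemma rpow_add_le_two_rpow_mul {x y r : ℝ} (hx : 0 ≤ x) (hy : 0 ≤ y) (hr : 0 ≤ r) :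
    (x + y) ^ r ≤ 2 ^ r * (x ^ r + y ^ r) := by
  have h : (x + y) ^ r ≤ (2 * max x y) ^ r :=
    rpow_le_rpow (by positivity) (by linarith [le_max_left x y, le_max_right x y]) hr
  rw [mul_rpow (by norm_num) (le_max_of_le_left hx)] at h
  refine h.trans ?_
  gcongr
  have h1 := rpow_nonneg hx r
  have h2 := rpow_nonneg hy r
  rcases max_cases x y with h | h <;> rw [h.1] <;> linarith

lemma bell_le (hε : 0 < ε) (hδ : 0 < δ) (hb0 : 0 < b) (hb : b < 1 / 2) (hk1 : 1 < k)
    (hk : k * (1 - 2 * b) = 1) (x y : ℝ) :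
    bell b k δ ε x y ≤ (1 + δ) * |x| ^ (2 * (1 - b)) + δ * (1 + 2 ^ (k * b)) * |y| ^ (k + 1) +
      δ * ((ε ^ 2) ^ b + 2 ^ (k * b) * (ε ^ 2) ^ (k * b)) * y ^ 2 := by
  have hs := sq_add_sq_pos hε x
  have hτ := sq_add_sq_pos hε y
  have hk0 : 0 < k := by linarith
  have h1 : (x ^ 2 + ε ^ 2) ^ (1 - b) ≤ |x| ^ (2 * (1 - b)) + (ε ^ 2) ^ (1 - b) := by
    rw [← sq_rpow_eq]
    exact rpow_add_le_add_rpow (sq_nonneg x) (sq_nonneg ε) (by linarith) (by linarith)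
  have h2 : bellW k ε x y ^ b ≤ (|x| ^ (2 * b) + (ε ^ 2) ^ b) +
      2 ^ (k * b) * (|y| ^ (2 * (k * b)) + (ε ^ 2) ^ (k * b)) := by
    rw [← sq_rpow_eq, ← sq_rpow_eq]
    refine (rpow_add_le_add_rpow hs.le (rpow_nonneg hτ.le k) hb0.le (by linarith)).trans ?_
    refine add_le_add (rpow_add_le_add_rpow (sq_nonneg x) (sq_nonneg ε) hb0.le (by linarith)) ?_
    rw [← rpow_mul hτ.le]
    exact rpow_add_le_two_rpow_mul (sq_nonneg y) (sq_nonneg ε) (by positivity)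
  have hkb : 2 * (k * b) + 2 = k + 1 := by linarith
  have h3 : y ^ 2 * |y| ^ (2 * (k * b)) = |y| ^ (k + 1) := by
    rw [← hkb, rpow_add_of_nonneg (abs_nonneg y) (by positivity) (by norm_num), mul_comm]
    norm_num
  have h4 : y ^ 2 * |x| ^ (2 * b) ≤ |x| ^ (2 * (1 - b)) + |y| ^ (k + 1) := by
    rcases eq_or_lt_of_le (abs_nonneg x) with hx | hx
    · rw [← hx, zero_rpow (by linarith), zero_rpow (by linarith)]
      simp; positivity
    have hb1 : 0 < 1 - b := by linarith
    have hyo := young_inequality_of_nonneg (a := y ^ 2) (b := |x| ^ (2 * b))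
      (p := (k + 1) / 2) (q := (1 - b) / b) (sq_nonneg y) (by positivity)
      (holderConjugate_iff.2 ⟨by linarith, by rw [inv_div, inv_div]; field_simp; linarith⟩)
    rw [sq_rpow_eq, ← rpow_mul (abs_nonneg x),
      show 2 * ((k + 1) / 2) = k + 1 by ring,
      show 2 * b * ((1 - b) / b) = 2 * (1 - b) by field_simp] at hyo
    refine hyo.trans ?_
    rw [add_comm]
    refine add_le_add (div_le_self (by positivity) ?_) (div_le_self (by positivity) ?_)
    · rw [le_div_iff₀ hb0]; linarith
    · linarith
  have h5 := mul_le_mul_of_nonneg_left h2 (sq_nonneg y)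
  have h6 : y ^ 2 * bellW k ε x y ^ b ≤ |x| ^ (2 * (1 - b)) + (1 + 2 ^ (k * b)) * |y| ^ (k + 1) +
      ((ε ^ 2) ^ b + 2 ^ (k * b) * (ε ^ 2) ^ (k * b)) * y ^ 2 := by
    have h7 : y ^ 2 * (2 ^ (k * b) * |y| ^ (2 * (k * b))) = 2 ^ (k * b) * |y| ^ (k + 1) := by
      rw [← h3]; ring
    linarith
  have h8 := mul_le_mul_of_nonneg_left h6 hδ.le
  rw [bell]
  linarith

end BellmanEstimates

/-- Bounded continuous functions on space-time. -/
def ContBdd (G : ℝ × R2 → ℝ) : Prop := Continuous G ∧ ∃ M, ∀ q, |G q| ≤ M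

lemma contBdd_heat (h : 𝓢(R2, ℝ)) : ContBdd fun q => heat q.1 h q.2 :=
  ⟨continuous_heat h, _, fun q => abs_heat_le q.1 h q.2⟩

lemma ContBdd.mul {G H : ℝ × R2 → ℝ} (hG : ContBdd G) (hH : ContBdd H) :
    ContBdd fun q => G q * H q := by
  obtain ⟨hGc, M, hM⟩ := hG
  obtain ⟨hHc, N, hN⟩ := hH
  refine ⟨hGc.mul hHc, M * N, fun q => ?_⟩
  rw [abs_mul]
  exact mul_le_mul (hM q) (hN q) (abs_nonneg _) ((abs_nonneg _).trans (hM q))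

lemma ContBdd.add {G H : ℝ × R2 → ℝ} (hG : ContBdd G) (hH : ContBdd H) :
    ContBdd fun q => G q + H q := by
  obtain ⟨hGc, M, hM⟩ := hG
  obtain ⟨hHc, N, hN⟩ := hH
  exact ⟨hGc.add hHc, M + N, fun q => (abs_add_le _ _).trans (add_le_add (hM q) (hN q))⟩

lemma contBdd_comp_heat {F : ℝ → ℝ → ℝ} (hF : Continuous fun q : ℝ × ℝ => F q.1 q.2)
    (f g : 𝓢(R2, ℝ)) : ContBdd fun q => F (heat q.1 f q.2) (heat q.1 g q.2) := by
  refine ⟨hF.comp ((continuous_heat f).prodMk (continuous_heat g)), ?_⟩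
  obtain ⟨M, hM⟩ := ((isCompact_Icc (a := -SchwartzMap.seminorm ℝ 0 0 f)
    (b := SchwartzMap.seminorm ℝ 0 0 f)).prod (isCompact_Icc (a := -SchwartzMap.seminorm ℝ 0 0 g)
    (b := SchwartzMap.seminorm ℝ 0 0 g))).exists_bound_of_continuousOn hF.continuousOn
  exact ⟨M, fun q => hM (heat q.1 f q.2, heat q.1 g q.2)
    ⟨abs_le.1 (abs_heat_le _ _ _), abs_le.1 (abs_heat_le _ _ _)⟩⟩

lemma ContBdd.integrable_prod {G : ℝ × R2 → ℝ} (hG : ContBdd G) (μ : Measure ℝ)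
    [IsFiniteMeasure μ] (h : 𝓢(R2, ℝ)) :
    Integrable (fun q => G q * heat q.1 h q.2) (μ.prod volume) := by
  obtain ⟨hGc, M, hM⟩ := hG
  exact (integrable_heat_prod μ h).bdd_mul hGc.aestronglyMeasurable (Eventually.of_forall hM)

lemma ContBdd.integrable_slice {G : ℝ × R2 → ℝ} (hG : ContBdd G) (t : ℝ) (h : 𝓢(R2, ℝ)) :
    Integrable (fun x => G (t, x) * heat t h x) := by
  obtain ⟨hGc, M, hM⟩ := hG
  exact (integrable_heat t h).bdd_mul
    (hGc.comp (by fun_prop : Continuous fun x : R2 => (t, x))).aestronglyMeasurable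
    (Eventually.of_forall fun x => hM (t, x))

/-- A `C²` function of two variables, with derivatives `Bx`, `By`, `Bxx`, `Bxy`, `Byy`, that is
convex in a way strong enough to control mixed products of gradients. -/
structure IsBellman (κ : ℝ) (B Bx By Bxx Bxy Byy : ℝ → ℝ → ℝ) : Prop where
  nonneg : ∀ x y, 0 ≤ B x y
  cont : Continuous fun q : ℝ × ℝ => B q.1 q.2
  contX : Continuous fun q : ℝ × ℝ => Bx q.1 q.2
  contY : Continuous fun q : ℝ × ℝ => By q.1 q.2
  contXX : Continuous fun q : ℝ × ℝ => Bxx q.1 q.2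
  contXY : Continuous fun q : ℝ × ℝ => Bxy q.1 q.2
  contYY : Continuous fun q : ℝ × ℝ => Byy q.1 q.2
  deriv : ∀ {u v : ℝ → ℝ} {u' v' t : ℝ}, HasDerivAt u u' t → HasDerivAt v v' t →
    HasDerivAt (fun t => B (u t) (v t)) (Bx (u t) (v t) * u' + By (u t) (v t) * v') t
  derivX : ∀ {u v : ℝ → ℝ} {u' v' t : ℝ}, HasDerivAt u u' t → HasDerivAt v v' t →
    HasDerivAt (fun t => Bx (u t) (v t)) (Bxx (u t) (v t) * u' + Bxy (u t) (v t) * v') t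
  derivY : ∀ {u v : ℝ → ℝ} {u' v' t : ℝ}, HasDerivAt u u' t → HasDerivAt v v' t →
    HasDerivAt (fun t => By (u t) (v t)) (Bxy (u t) (v t) * u' + Byy (u t) (v t) * v') t
  hess : ∀ (x y : ℝ) (a c : Fin 2 → ℝ) (i j : Fin 2), κ * |a i * c j| ≤
    ∑ l, (Bxx x y * a l ^ 2 + 2 * Bxy x y * (a l * c l) + Byy x y * c l ^ 2)

section Flow

variable {κ : ℝ} {B Bx By Bxx Bxy Byy : ℝ → ℝ → ℝ}

/-- Integration by parts of a composition with heat extensions against a Laplacian. -/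
lemma integral_comp_heat_mul_eq_neg {F Fx Fy : ℝ → ℝ → ℝ}
    (hF : Continuous fun q : ℝ × ℝ => F q.1 q.2) (hFx : Continuous fun q : ℝ × ℝ => Fx q.1 q.2)
    (hFy : Continuous fun q : ℝ × ℝ => Fy q.1 q.2)
    (hd : ∀ {u v : ℝ → ℝ} {u' v' t : ℝ}, HasDerivAt u u' t → HasDerivAt v v' t →
      HasDerivAt (fun t => F (u t) (v t)) (Fx (u t) (v t) * u' + Fy (u t) (v t) * v') t)
    (f g h : 𝓢(R2, ℝ)) (t : ℝ) (i : Fin 2) :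
    ∫ x, F (heat t f x) (heat t g x) * heat t (D i h) x =
      -∫ x, (Fx (heat t f x) (heat t g x) * heat t (D i f) x +
        Fy (heat t f x) (heat t g x) * heat t (D i g) x) * heat t h x := by
  refine integral_bilinear_hasLineDerivAt_right_eq_neg_left_of_integrable (μ := volume)
    (B := ContinuousLinearMap.mul ℝ ℝ) (v := e i)
    (f := fun x => F (heat t f x) (heat t g x))
    (f' := fun x => Fx (heat t f x) (heat t g x) * heat t (D i f) x +
        Fy (heat t f x) (heat t g x) * heat t (D i g) x)
    (g := heat t h) (g' := heat t (D i h))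
    ((((contBdd_comp_heat hFx f g).mul (contBdd_heat _)).add
      ((contBdd_comp_heat hFy f g).mul (contBdd_heat _))).integrable_slice t h)
    ((contBdd_comp_heat hF f g).integrable_slice t _)
    ((contBdd_comp_heat hF f g).integrable_slice t _) (fun x _ => ?_)
    (fun x _ => heat_hasLineDerivAt t h i x)
  have h1 := hd (heat_hasLineDerivAt t f i x) (heat_hasLineDerivAt t g i x)
  simpa [HasLineDerivAt] using h1

lemma IsBellman.integral_laplacian (hB : IsBellman κ B Bx By Bxx Bxy Byy) (f g : 𝓢(R2, ℝ))
    (t : ℝ) :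
    ∫ x, (Bx (heat t f x) (heat t g x) * ∑ l, heat t (D l (D l f)) x +
      By (heat t f x) (heat t g x) * ∑ l, heat t (D l (D l g)) x) =
    -∫ x, ∑ l, (Bxx (heat t f x) (heat t g x) * heat t (D l f) x ^ 2 +
      2 * Bxy (heat t f x) (heat t g x) * (heat t (D l f) x * heat t (D l g) x) +
      Byy (heat t f x) (heat t g x) * heat t (D l g) x ^ 2) := by
  have hX := contBdd_comp_heat hB.contX f g
  have hY := contBdd_comp_heat hB.contY f g
  have hXX := contBdd_comp_heat hB.contXX f g
  have hXY := contBdd_comp_heat hB.contXY f g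
  have hYY := contBdd_comp_heat hB.contYY f g
  have h1 : ∀ l, Integrable fun x => Bx (heat t f x) (heat t g x) * heat t (D l (D l f)) x +
      By (heat t f x) (heat t g x) * heat t (D l (D l g)) x := fun l =>
    (hX.integrable_slice t _).add (hY.integrable_slice t _)
  have h2 : ∀ l, Integrable fun x =>
      (Bxx (heat t f x) (heat t g x) * heat t (D l f) x +
        Bxy (heat t f x) (heat t g x) * heat t (D l g) x) * heat t (D l f) x := fun l =>
    ((hXX.mul (contBdd_heat _)).add (hXY.mul (contBdd_heat _))).integrable_slice t _
  have h3 : ∀ l, Integrable fun x =>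
      (Bxy (heat t f x) (heat t g x) * heat t (D l f) x +
        Byy (heat t f x) (heat t g x) * heat t (D l g) x) * heat t (D l g) x := fun l =>
    ((hXY.mul (contBdd_heat _)).add (hYY.mul (contBdd_heat _))).integrable_slice t _
  have h4 : ∀ l x, Bxx (heat t f x) (heat t g x) * heat t (D l f) x ^ 2 +
      2 * Bxy (heat t f x) (heat t g x) * (heat t (D l f) x * heat t (D l g) x) +
      Byy (heat t f x) (heat t g x) * heat t (D l g) x ^ 2 =
      (Bxx (heat t f x) (heat t g x) * heat t (D l f) x +
        Bxy (heat t f x) (heat t g x) * heat t (D l g) x) * heat t (D l f) x +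
      (Bxy (heat t f x) (heat t g x) * heat t (D l f) x +
        Byy (heat t f x) (heat t g x) * heat t (D l g) x) * heat t (D l g) x := fun l x => by ring
  have h5 := fun l => Integrable.fun_add (h2 l) (h3 l)
  simp only [h4, Finset.mul_sum, ← Finset.sum_add_distrib]
  rw [integral_finsetSum _ fun l _ => h1 l, integral_finsetSum _ fun l _ => h5 l,
    ← Finset.sum_neg_distrib]
  refine Finset.sum_congr rfl fun l _ => ?_
  rw [integral_add (hX.integrable_slice t _) (hY.integrable_slice t _),
    integral_add (h2 l) (h3 l), neg_add,
    integral_comp_heat_mul_eq_neg hB.contX hB.contXX hB.contXY hB.derivX,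
    integral_comp_heat_mul_eq_neg hB.contY hB.contXY hB.contYY hB.derivY]

/-- The bilinear embedding: the Bellman function controls mixed products of gradients of heat
extensions. -/
lemma IsBellman.bilinear_embedding (hB : IsBellman κ B Bx By Bxx Bxy Byy) (hκ : 0 < κ)
    {S : ℝ} (hS : 0 < S) (f g : 𝓢(R2, ℝ)) (hInt : Integrable fun x => B (f x) (g x))
    (i j : Fin 2) :
    κ * |∫ t in 0..S, ∫ x, heat t (D i f) x * heat t (D j g) x| ≤ ∫ x, B (f x) (g x) := by
  have hX := contBdd_comp_heat hB.contX f g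
  have hY := contBdd_comp_heat hB.contY f g
  have hXX := contBdd_comp_heat hB.contXX f g
  have hXY := contBdd_comp_heat hB.contXY f g
  have hYY := contBdd_comp_heat hB.contYY f g
  set μ : Measure ℝ := volume.restrict (Set.Ioc 0 S) with hμ
  let L : ℝ → R2 → ℝ := fun t x =>
    Bx (heat t f x) (heat t g x) * ∑ l, heat t (D l (D l f)) x +
      By (heat t f x) (heat t g x) * ∑ l, heat t (D l (D l g)) x
  let Q : ℝ → R2 → ℝ := fun t x =>
    ∑ l, (Bxx (heat t f x) (heat t g x) * heat t (D l f) x ^ 2 +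
      2 * Bxy (heat t f x) (heat t g x) * (heat t (D l f) x * heat t (D l g) x) +
      Byy (heat t f x) (heat t g x) * heat t (D l g) x ^ 2)
  have hL : Integrable (Function.uncurry L) (μ.prod volume) := by
    have h : ∀ l, Integrable (fun q : ℝ × R2 =>
        Bx (heat q.1 f q.2) (heat q.1 g q.2) * heat q.1 (D l (D l f)) q.2 +
        By (heat q.1 f q.2) (heat q.1 g q.2) * heat q.1 (D l (D l g)) q.2) (μ.prod volume) :=
      fun l => (hX.integrable_prod μ _).add (hY.integrable_prod μ _)
    refine (integrable_finsetSum Finset.univ fun l _ => h l).congr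
      (Eventually.of_forall fun q => ?_)
    simp only [Function.uncurry, L, Finset.mul_sum, ← Finset.sum_add_distrib]
  have hQ : Integrable (Function.uncurry Q) (μ.prod volume) := by
    refine (integrable_finsetSum Finset.univ fun l _ =>
      ((((hXX.mul (contBdd_heat (D l f))).add
        (hXY.mul (contBdd_heat (D l g)))).integrable_prod μ (D l f)).add
      (((hXY.mul (contBdd_heat (D l f))).add
        (hYY.mul (contBdd_heat (D l g)))).integrable_prod μ (D l g)))).congr
      (Eventually.of_forall fun q => ?_)
    simp only [Function.uncurry, Q]
    refine Finset.sum_congr rfl fun l _ => ?_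
    simp only [Pi.add_apply]
    ring
  have hac : Integrable (fun q : ℝ × R2 => heat q.1 (D i f) q.2 * heat q.1 (D j g) q.2)
      (μ.prod volume) := (contBdd_heat (D i f)).integrable_prod μ (D j g)
  have hcont : ∀ (h : 𝓢(R2, ℝ)) (x : R2), Continuous fun t => heat t h x := fun h x =>
    (continuous_heat h).comp (continuous_id.prodMk continuous_const)
  have hftc : ∀ x, ∫ t, L t x ∂μ = B (heat S f x) (heat S g x) - B (f x) (g x) := by
    intro x
    rw [hμ, ← intervalIntegral.integral_of_le hS.le,
      intervalIntegral.integral_eq_sub_of_hasDerivAt_of_le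
        (f := fun t => B (heat t f x) (heat t g x)) hS.le
      (hB.cont.comp ((hcont f x).prodMk (hcont g x))).continuousOn
      (fun t ht => hB.deriv (heat_hasDerivAt ht.1 f x) (heat_hasDerivAt ht.1 g x))]
    · simp [heat_zero]
    · refine Continuous.intervalIntegrable ?_ _ _
      exact ((hB.contX.comp ((hcont f x).prodMk (hcont g x))).mul
          (continuous_finsetSum _ fun l _ => hcont _ x)).add
        ((hB.contY.comp ((hcont f x).prodMk (hcont g x))).mul
          (continuous_finsetSum _ fun l _ => hcont _ x))
  have h1 : ∫ q, Function.uncurry Q q ∂(μ.prod volume) ≤ ∫ x, B (f x) (g x) := by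
    calc ∫ q, Function.uncurry Q q ∂(μ.prod volume)
        = -∫ q, Function.uncurry L q ∂(μ.prod volume) := by
          rw [integral_prod _ hQ, integral_prod _ hL, ← integral_neg]
          refine integral_congr_ae (Eventually.of_forall fun t => ?_)
          have := hB.integral_laplacian f g t
          simp only [Function.uncurry, L, Q]
          linarith
      _ = ∫ x, -∫ t, L t x ∂μ := by rw [integral_prod_symm _ hL, integral_neg]; rfl
      _ ≤ _ := by
          refine integral_mono hL.integral_prod_right.neg hInt fun x => ?_
          have := hB.nonneg (heat S f x) (heat S g x)
          have h := hftc x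
          linarith
  refine le_trans ?_ h1
  rw [intervalIntegral.integral_of_le hS.le,
    ← integral_prod (fun q : ℝ × R2 => heat q.1 (D i f) q.2 * heat q.1 (D j g) q.2) hac]
  calc κ * |∫ q : ℝ × R2, heat q.1 (D i f) q.2 * heat q.1 (D j g) q.2 ∂(μ.prod volume)|
      ≤ κ * ∫ q : ℝ × R2, |heat q.1 (D i f) q.2 * heat q.1 (D j g) q.2| ∂(μ.prod volume) := by
        gcongr; exact abs_integral_le_integral_abs
    _ = ∫ q : ℝ × R2, κ * |heat q.1 (D i f) q.2 * heat q.1 (D j g) q.2| ∂(μ.prod volume) :=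
        (integral_const_mul _ _).symm
    _ ≤ _ := integral_mono (hac.abs.const_mul κ) hQ fun q =>
        hB.hess _ _ (fun l => heat q.1 (D l f) q.2) (fun l => heat q.1 (D l g) q.2) i j

end Flow

section Exists

variable {P q : ℝ}

lemma exists_isBellman (hP : 1 < P) (hP2 : P < 2) (hq : q = P / (P - 1)) :
    ∃ κ M : ℝ, 0 < κ ∧ 0 < M ∧ ∀ η > 0, ∃ B Bx By Bxx Bxy Byy : ℝ → ℝ → ℝ,
      IsBellman κ B Bx By Bxx Bxy Byy ∧
      ∀ x y, B x y ≤ M * (|x| ^ P + |y| ^ q + η * y ^ 2) := by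
  obtain ⟨b, rfl⟩ : ∃ b, P = 2 * (1 - b) := ⟨1 - P / 2, by ring⟩
  have hb0 : 0 < b := by linarith
  have hb : b < 1 / 2 := by linarith
  obtain ⟨k, hk⟩ : ∃ k, k = 1 / (1 - 2 * b) := ⟨_, rfl⟩
  have hb2 : 0 < 1 - 2 * b := by linarith
  have hk' : k * (1 - 2 * b) = 1 := by rw [hk]; field_simp
  have hk1 : 1 < k := by rw [hk, lt_div_iff₀ hb2]; linarith
  have hqk : q = k + 1 := by
    rw [hq, hk, show 2 * (1 - b) - 1 = 1 - 2 * b by ring]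
    field_simp
    ring
  set m := (1 - b) * (1 - 2 * b) with hm
  set A := 2 * b + (4 * b + 4 * b * k * (1 - b)) ^ 2 with hA
  have hm0 : 0 < m := mul_pos (by linarith) hb2
  have hA0 : 0 ≤ A := by positivity
  set δ := m / (1 + A) with hδd
  have hδ : 0 < δ := by positivity
  have hδm : δ * (1 + A) = m := by rw [hδd]; field_simp
  have hδ1 : δ ≤ m := by nlinarith
  have hδ2 : δ * A ≤ m := by nlinarith
  refine ⟨2 * δ, 1 + δ + δ * (1 + 2 ^ (k * b)), by positivity, by positivity, fun η hη => ?_⟩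
  obtain ⟨ε, hε, hεη⟩ : ∃ ε > 0, (ε ^ 2) ^ b + 2 ^ (k * b) * (ε ^ 2) ^ (k * b) < η := by
    have hkb : 0 < k * b := by positivity
    have hc : Continuous fun ε : ℝ => (ε ^ 2) ^ b + 2 ^ (k * b) * (ε ^ 2) ^ (k * b) :=
      ((continuous_pow 2).rpow_const fun _ => Or.inr hb0.le).add
        (continuous_const.mul ((continuous_pow 2).rpow_const fun _ => Or.inr hkb.le))
    have h0 : Tendsto (fun ε : ℝ => (ε ^ 2) ^ b + 2 ^ (k * b) * (ε ^ 2) ^ (k * b)) (𝓝[>] 0)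
        (𝓝 0) := by
      have := (hc.tendsto 0).mono_left (nhdsWithin_le_nhds (s := Set.Ioi 0))
      simpa [zero_rpow hb0.ne', zero_rpow hkb.ne'] using this
    obtain ⟨ε, h1, h2⟩ := ((h0.eventually_lt_const hη).and self_mem_nhdsWithin).exists
    exact ⟨ε, h2, h1⟩
  refine ⟨bell b k δ ε, bellX b k δ ε, bellY b k δ ε, bellXX b k δ ε, bellXY b k δ ε,
    bellYY b k δ ε, ⟨bell_nonneg hε hδ hb, continuous_bell hε, continuous_bellX hε,
      continuous_bellY hε, continuous_bellXX hε, continuous_bellXY hε, continuous_bellYY hε,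
      hasDerivAt_bell hε, hasDerivAt_bellX hε, hasDerivAt_bellY hε,
      bellman_hessian_sum_ge hε hδ hb0 hb hk1 hk' hδ1 hδ2⟩, fun x y => ?_⟩
  refine (bell_le hε hδ hb0 hb hk1 hk' x y).trans ?_
  rw [hqk]
  have h1 : 0 ≤ |x| ^ (2 * (1 - b)) := by positivity
  have h2 : 0 ≤ |y| ^ (k + 1) := by positivity
  have h3 : 0 ≤ η * y ^ 2 := by positivity
  have h4 : ((ε ^ 2) ^ b + 2 ^ (k * b) * (ε ^ 2) ^ (k * b)) * y ^ 2 ≤ η * y ^ 2 := by gcongr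
  have h5 : (0 : ℝ) < 2 ^ (k * b) := by positivity
  calc _ = (1 + δ) * |x| ^ (2 * (1 - b)) + δ * (1 + 2 ^ (k * b)) * |y| ^ (k + 1) +
        δ * (((ε ^ 2) ^ b + 2 ^ (k * b) * (ε ^ 2) ^ (k * b)) * y ^ 2) := by ring
    _ ≤ (1 + δ + δ * (1 + 2 ^ (k * b))) * |x| ^ (2 * (1 - b)) +
        (1 + δ + δ * (1 + 2 ^ (k * b))) * |y| ^ (k + 1) +
        (1 + δ + δ * (1 + 2 ^ (k * b))) * (η * y ^ 2) := by
      have h6 : 0 ≤ δ * 2 ^ (k * b) := by positivity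
      gcongr <;> nlinarith
    _ = _ := by ring

lemma integrable_abs_rpow (f : 𝓢(R2, ℝ)) {r : ℝ} (hr : 0 < r) :
    Integrable fun x => |f x| ^ r := by
  have h := (f.memLp (ENNReal.ofReal r)).integrable_norm_rpow
    (by simpa using hr) ENNReal.ofReal_ne_top
  simpa [ENNReal.toReal_ofReal hr.le] using h

/-- The dimension-free bilinear estimate for gradients of heat extensions. -/
lemma exists_bilinear_bound (hP : 1 < P) (hP2 : P < 2) (hq : q = P / (P - 1)) :
    ∃ C > 0, ∀ (f g : 𝓢(R2, ℝ)) (S : ℝ), 0 < S → ∀ i j : Fin 2,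
      |∫ t in 0..S, ∫ x, heat t (D i f) x * heat t (D j g) x| ≤
        C * ((∫ x, |f x| ^ P) + ∫ x, |g x| ^ q) := by
  obtain ⟨κ, M, hκ, hM, h⟩ := exists_isBellman hP hP2 hq
  refine ⟨κ⁻¹ * M, by positivity, fun f g S hS i j => ?_⟩
  have hq0 : 0 < q := by rw [hq]; exact div_pos (by linarith) (by linarith)
  have hf := integrable_abs_rpow f (by linarith : 0 < P)
  have hg := integrable_abs_rpow g hq0
  have hg2 : Integrable fun x => g x ^ 2 := by
    simpa using integrable_abs_rpow g (two_pos)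
  have key : ∀ η > 0, |∫ t in 0..S, ∫ x, heat t (D i f) x * heat t (D j g) x| ≤
      κ⁻¹ * M * ((∫ x, |f x| ^ P) + (∫ x, |g x| ^ q) + η * ∫ x, g x ^ 2) := by
    intro η hη
    obtain ⟨B, Bx, By, Bxx, Bxy, Byy, hB, hle⟩ := h η hη
    have hi : Integrable fun x => M * (|f x| ^ P + |g x| ^ q + η * g x ^ 2) :=
      ((hf.add hg).add (hg2.const_mul η)).const_mul M
    have hInt : Integrable fun x => B (f x) (g x) := by
      refine hi.mono' (hB.cont.comp (f.continuous.prodMk g.continuous)).aestronglyMeasurable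
        (Eventually.of_forall fun x => ?_)
      rw [norm_of_nonneg (hB.nonneg _ _)]
      exact hle _ _
    have h1 := hB.bilinear_embedding hκ hS f g hInt i j
    have h2 := integral_mono hInt hi fun x => hle _ _
    rw [integral_const_mul, integral_add (hf.fun_add hg) (hg2.const_mul η), integral_add hf hg,
      integral_const_mul] at h2
    rw [mul_assoc, le_inv_mul_iff₀ hκ]
    exact h1.trans h2
  have hlim : Tendsto (fun η : ℝ => κ⁻¹ * M * ((∫ x, |f x| ^ P) + (∫ x, |g x| ^ q) +
      η * ∫ x, g x ^ 2)) (𝓝[>] 0) (𝓝 (κ⁻¹ * M * ((∫ x, |f x| ^ P) + ∫ x, |g x| ^ q))) := by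
    have hc : Continuous fun η : ℝ => κ⁻¹ * M * ((∫ x, |f x| ^ P) + (∫ x, |g x| ^ q) +
      η * ∫ x, g x ^ 2) := by fun_prop
    simpa using (hc.tendsto 0).mono_left (nhdsWithin_le_nhds (s := Set.Ioi 0))
  exact ge_of_tendsto hlim (eventually_mem_nhdsWithin.mono fun η hη => key η hη)

end Exists

/-- The heat extension integrated over the time interval `[0, S]`. -/
def heatIntegral (S : ℝ) (f : 𝓢(R2, ℝ)) (x : R2) : ℝ := ∫ t in 0..S, heat t f x

section HeatIntegral

variable {S : ℝ}

lemma integrable_heatIntegral (hS : 0 < S) (f : 𝓢(R2, ℝ)) : Integrable (heatIntegral S f) := by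
  have h := (integrable_heat_prod (volume.restrict (Set.Ioc 0 S)) f).integral_prod_right
  refine h.congr (Eventually.of_forall fun x => ?_)
  simp only [heatIntegral, intervalIntegral.integral_of_le hS.le]

lemma abs_heatIntegral_le (hS : 0 < S) (f : 𝓢(R2, ℝ)) (x : R2) :
    |heatIntegral S f x| ≤ SchwartzMap.seminorm ℝ 0 0 f * S := by
  have h := intervalIntegral.norm_integral_le_of_norm_le_const (a := 0) (b := S)
    (f := fun t => heat t f x) (C := SchwartzMap.seminorm ℝ 0 0 f) fun t _ => abs_heat_le t f x
  simpa [heatIntegral, abs_of_pos hS] using h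

lemma integrable_abs_heatIntegral_rpow (hS : 0 < S) (f : 𝓢(R2, ℝ)) {P : ℝ} (hP : 1 < P) :
    Integrable fun x => |heatIntegral S f x| ^ P := by
  have h := integrable_heatIntegral hS f
  have hm : AEStronglyMeasurable (fun x => |heatIntegral S f x| ^ P) :=
    ((Measurable.pow_const measurable_id P).comp_aemeasurable
      h.aestronglyMeasurable.aemeasurable.abs).aestronglyMeasurable
  refine (h.abs.const_mul ((SchwartzMap.seminorm ℝ 0 0 f * S) ^ (P - 1))).mono' hm
    (Eventually.of_forall fun x => ?_)
  rw [norm_of_nonneg (by positivity)]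
  have : |heatIntegral S f x| ^ P = |heatIntegral S f x| ^ (P - 1) * |heatIntegral S f x| := by
    rw [← rpow_add_one' (abs_nonneg _) (by linarith), sub_add_cancel]
  rw [this]
  gcongr
  exact abs_heatIntegral_le hS f x

lemma integral_heatIntegral_mul (hS : 0 < S) (f g : 𝓢(R2, ℝ)) (i j : Fin 2) :
    ∫ x, heatIntegral S (D j (D i f)) x * g x =
      -(2 * ∫ t in 0..S / 2, ∫ x, heat t (D i f) x * heat t (D j g) x) := by
  have hslice : ∀ t, ∫ x, heat t (D j (D i f)) x * g x =
      -∫ x, heat (t / 2) (D i f) x * heat (t / 2) (D j g) x := by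
    intro t
    have h1 := integral_heat_mul_heat (t / 2) (D j (D i f)) g
    rw [mul_div_cancel₀ t (two_ne_zero' ℝ)] at h1
    have h2 := integral_comp_heat_mul_eq_neg (F := fun x _ => x) (Fx := fun _ _ => 1)
      (Fy := fun _ _ => 0) continuous_fst continuous_const continuous_const
      (fun hu _ => by simpa using hu) g g (D i f) (t / 2) j
    simp only [one_mul, zero_mul, add_zero] at h2
    rw [← h1]
    simp only [mul_comm (heat (t / 2) (D j (D i f)) _), h2,
      mul_comm (heat (t / 2) (D i f) _)]
  have hInt : Integrable (fun q : ℝ × R2 => heat q.1 (D j (D i f)) q.2 * g q.2)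
      ((volume.restrict (Set.Ioc 0 S)).prod volume) := by
    refine (integrable_heat_prod _ _).mul_bdd (c := SchwartzMap.seminorm ℝ 0 0 g)
      (g.continuous.comp continuous_snd).aestronglyMeasurable
      (Eventually.of_forall fun q => abs_le_seminorm g q.2)
  calc ∫ x, heatIntegral S (D j (D i f)) x * g x
      = ∫ x, ∫ t in Set.Ioc 0 S, heat t (D j (D i f)) x * g x := by
        simp only [heatIntegral, intervalIntegral.integral_of_le hS.le, integral_mul_const]
    _ = ∫ t in Set.Ioc 0 S, ∫ x, heat t (D j (D i f)) x * g x := by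
        rw [← integral_prod _ hInt, integral_prod_symm _ hInt]
    _ = -∫ t in 0..S, ∫ x, heat (t / 2) (D i f) x * heat (t / 2) (D j g) x := by
        simp only [hslice, integral_neg, intervalIntegral.integral_of_le hS.le]
    _ = _ := by
        rw [intervalIntegral.integral_comp_div
          (fun t => ∫ x, heat t (D i f) x * heat t (D j g) x) two_ne_zero]
        simp

end HeatIntegral

section Duality

variable {P q : ℝ}

lemma abs_integral_mul_le_of_schwartz (hPq : P.HolderConjugate q) {h : R2 → ℝ}
    (hh : MemLp h (ENNReal.ofReal P)) {K A : ℝ}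
    (hb : ∀ g : 𝓢(R2, ℝ), |∫ x, h x * g x| ≤ K * (A + ∫ x, |g x| ^ q))
    {G : R2 → ℝ} (hG : MemLp G (ENNReal.ofReal q)) :
    |∫ x, h x * G x| ≤ K * (A + ∫ x, |G x| ^ q) := by
  have : ENNReal.HolderConjugate (ENNReal.ofReal P) (ENNReal.ofReal q) := hPq.ennrealOfReal
  have : Fact (1 ≤ ENNReal.ofReal P) := ⟨by simpa using hPq.lt.le⟩
  have : Fact (1 ≤ ENNReal.ofReal q) := ⟨by simpa using hPq.symm.lt.le⟩
  have hq0 : 0 < q := hPq.symm.pos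
  have hnorm : ∀ u : Lp ℝ (ENNReal.ofReal q) (volume : Measure R2),
      ‖u‖ ^ q = ∫ x, |u x| ^ q := by
    intro u
    rw [Lp.norm_def, (Lp.memLp u).eLpNorm_eq_integral_rpow_norm (by simpa using hq0)
      ENNReal.ofReal_ne_top, ENNReal.toReal_ofReal hq0.le, ENNReal.toReal_ofReal (by positivity),
      ← rpow_mul (by positivity), inv_mul_cancel₀ hq0.ne', rpow_one]
    rfl
  let T := (ContinuousLinearMap.mul ℝ ℝ).lpPairing (volume : Measure R2) (ENNReal.ofReal P)
    (ENNReal.ofReal q) hh.toLp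
  have hT : ∀ u : Lp ℝ (ENNReal.ofReal q) (volume : Measure R2), T u = ∫ x, h x * u x := by
    intro u
    rw [ContinuousLinearMap.lpPairing_eq_integral]
    refine integral_congr_ae ?_
    filter_upwards [hh.coeFn_toLp] with x hx
    simp [hx]
  have hcl : IsClosed {u : Lp ℝ (ENNReal.ofReal q) (volume : Measure R2) |
      |T u| ≤ K * (A + ‖u‖ ^ q)} :=
    isClosed_le T.continuous.abs (continuous_const.mul (continuous_const.add
      (continuous_norm.rpow_const fun _ => Or.inr hq0.le)))
  have hall : ∀ u : Lp ℝ (ENNReal.ofReal q) (volume : Measure R2),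
      |T u| ≤ K * (A + ‖u‖ ^ q) := by
    intro u
    refine (SchwartzMap.denseRange_toLpCLM (E := R2) (F := ℝ) (μ := volume)
      (p := ENNReal.ofReal q) ENNReal.ofReal_ne_top).induction_on u hcl fun g => ?_
    have hg := SchwartzMap.coeFn_toLp g (ENNReal.ofReal q) (volume : Measure R2)
    have h1 : T (g.toLp (ENNReal.ofReal q)) = ∫ x, h x * g x := by
      rw [hT]
      refine integral_congr_ae ?_
      filter_upwards [hg] with x hx
      rw [hx]
    have h2 : ‖g.toLp (ENNReal.ofReal q) (volume : Measure R2)‖ ^ q = ∫ x, |g x| ^ q := by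
      rw [hnorm]
      refine integral_congr_ae ?_
      filter_upwards [hg] with x hx
      rw [hx]
    change |T (g.toLp (ENNReal.ofReal q))| ≤ K * (A + ‖g.toLp (ENNReal.ofReal q)‖ ^ q)
    rw [h1, h2]
    exact hb g
  have := hall (hG.toLp G)
  rw [hT, hnorm] at this
  have e1 : ∫ x, h x * hG.toLp G x = ∫ x, h x * G x := by
    refine integral_congr_ae ?_
    filter_upwards [hG.coeFn_toLp] with x hx
    rw [hx]
  have e2 : ∫ x, |hG.toLp G x| ^ q = ∫ x, |G x| ^ q := by
    refine integral_congr_ae ?_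
    filter_upwards [hG.coeFn_toLp] with x hx
    rw [hx]
  rwa [e1, e2] at this

lemma integral_rpow_le_of_schwartz (hPq : P.HolderConjugate q) {h : R2 → ℝ}
    (hh : MemLp h (ENNReal.ofReal P)) {K A : ℝ} (hK : 0 < K)
    (hb : ∀ g : 𝓢(R2, ℝ), |∫ x, h x * g x| ≤ K * (A + ∫ x, |g x| ^ q)) :
    ∫ x, |h x| ^ P ≤ (2 * K) ^ P * A := by
  have hP1 : 1 < P := hPq.lt
  have hP0 : 0 < P := hPq.pos
  have hq0 : 0 < q := hPq.symm.pos
  set c := (2 * K) ^ (-(P - 1)) with hc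
  have hc0 : 0 < c := by positivity
  have hPq' : (P - 1) * q = P := hPq.sub_one_mul_conj
  have hcq : c ^ q * (2 * K) = c := by
    have : (-(P - 1) * q + 1) = -(P - 1) := by linarith
    rw [hc, ← rpow_mul (by positivity), ← rpow_add_one (by positivity), this]
  let G : R2 → ℝ := fun x => c * (h x * |h x| ^ (P - 2))
  have hpow : ∀ x, |h x| * |h x| ^ (P - 2) = |h x| ^ (P - 1) := by
    intro x
    rw [mul_comm, ← rpow_add_one' (abs_nonneg _) (by linarith)]
    congr 1; ring
  have habs : ∀ x, |G x| ^ q = c ^ q * |h x| ^ P := by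
    intro x
    simp only [G]
    rw [abs_mul, abs_mul, abs_of_pos hc0, abs_of_nonneg (by positivity : 0 ≤ |h x| ^ (P - 2)),
      hpow, mul_rpow hc0.le (by positivity), ← rpow_mul (abs_nonneg _), hPq']
  have hmul : ∀ x, h x * G x = c * |h x| ^ P := by
    intro x
    have h1 : |h x| ^ P = |h x| ^ (P - 1) * |h x| := by
      rw [← rpow_add_one' (abs_nonneg _) (by linarith), sub_add_cancel]
    rw [h1, ← hpow]
    simp only [G]
    linear_combination -c * |h x| ^ (P - 2) * abs_mul_abs_self (h x)
  have hPint : Integrable fun x => |h x| ^ P := by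
    have := hh.integrable_norm_rpow (by simpa using hP0) ENNReal.ofReal_ne_top
    simpa [ENNReal.toReal_ofReal hP0.le] using this
  have hGm : AEStronglyMeasurable G := by
    have := hh.1.aemeasurable
    exact ((this.mul (this.abs.pow_const (P - 2))).const_mul c).aestronglyMeasurable
  have hG : MemLp G (ENNReal.ofReal q) := by
    rw [← integrable_norm_rpow_iff hGm (by simpa using hq0) ENNReal.ofReal_ne_top,
      ENNReal.toReal_ofReal hq0.le]
    simp only [norm_eq_abs, habs]
    exact hPint.const_mul _
  have key := abs_integral_mul_le_of_schwartz hPq hh hb hG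
  simp only [hmul, habs, integral_const_mul] at key
  have hN : 0 ≤ ∫ x, |h x| ^ P := integral_nonneg fun x => by positivity
  rw [abs_of_nonneg (by positivity)] at key
  have h1 : c * ∫ x, |h x| ^ P ≤ 2 * K * A := by
    have : K * (c ^ q * ∫ x, |h x| ^ P) = (c * ∫ x, |h x| ^ P) / 2 := by
      linear_combination (∫ x, |h x| ^ P) / 2 * hcq
    linarith
  have h2 : (2 * K) ^ P = c⁻¹ * (2 * K) := by
    rw [hc, ← rpow_neg (by positivity), ← rpow_add_one (by positivity)]
    congr 1; ring
  rw [h2, mul_assoc, le_inv_mul_iff₀ hc0]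
  exact h1

end Duality

section MainEstimate

variable {P : ℝ}

lemma memLp_heatIntegral {S : ℝ} (hS : 0 < S) (f : 𝓢(R2, ℝ)) (hP : 1 < P) :
    MemLp (heatIntegral S f) (ENNReal.ofReal P) := by
  have hP0 : 0 < P := by linarith
  rw [← integrable_norm_rpow_iff (integrable_heatIntegral hS f).aestronglyMeasurable
    (by simpa using hP0) ENNReal.ofReal_ne_top, ENNReal.toReal_ofReal hP0.le]
  exact integrable_abs_heatIntegral_rpow hS f hP

lemma eLpNorm_ofReal_eq {h : R2 → ℝ} (hP : 0 < P) (hh : MemLp h (ENNReal.ofReal P)) :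
    eLpNorm h (ENNReal.ofReal P) volume = ENNReal.ofReal ((∫ x, |h x| ^ P) ^ P⁻¹) := by
  rw [hh.eLpNorm_eq_integral_rpow_norm (by simpa using hP) ENNReal.ofReal_ne_top,
    ENNReal.toReal_ofReal hP.le]
  rfl

lemma exists_eLpNorm_conv_le (hP : 1 < P) (hP2 : P < 2) :
    ∃ C > 0, ∀ (f : 𝓢(R2, ℝ)) (i j : Fin 2), eLpNorm (conv j (D i f)) (ENNReal.ofReal P) volume ≤
      ENNReal.ofReal C * eLpNorm f (ENNReal.ofReal P) volume := by
  obtain ⟨C, hC, hbil⟩ := exists_bilinear_bound hP hP2 rfl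
  have hP0 : 0 < P := by linarith
  have hPq : P.HolderConjugate (P / (P - 1)) := Real.HolderConjugate.conjExponent hP
  refine ⟨2 * (2 * C), by positivity, fun f i j => ?_⟩
  have hS : ∀ S > 0, eLpNorm (heatIntegral S (D j (D i f))) (ENNReal.ofReal P) volume ≤
      ENNReal.ofReal (2 * (2 * C)) * eLpNorm f (ENNReal.ofReal P) volume := by
    intro S hS
    have hm := memLp_heatIntegral hS (D j (D i f)) hP
    have hA : 0 ≤ ∫ x, |f x| ^ P := integral_nonneg fun x => by positivity
    have h1 : ∫ x, |heatIntegral S (D j (D i f)) x| ^ P ≤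
        (2 * (2 * C)) ^ P * ∫ x, |f x| ^ P := by
      refine integral_rpow_le_of_schwartz hPq hm (by positivity) fun g => ?_
      rw [integral_heatIntegral_mul hS, abs_neg, abs_mul, abs_two, mul_assoc]
      gcongr
      exact hbil f g (S / 2) (by positivity) i j
    rw [eLpNorm_ofReal_eq hP0 hm, eLpNorm_ofReal_eq hP0 (f.memLp _),
      ← ENNReal.ofReal_mul (by positivity)]
    refine ENNReal.ofReal_le_ofReal ?_
    calc _ ≤ ((2 * (2 * C)) ^ P * ∫ x, |f x| ^ P) ^ P⁻¹ := by gcongr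
      _ = _ := by
        rw [mul_rpow (by positivity) hA, ← rpow_mul (by positivity), mul_inv_cancel₀ hP0.ne',
          rpow_one]
  refine (Lp.eLpNorm_lim_le_liminf_eLpNorm
    (f := fun n : ℕ => heatIntegral ((n : ℝ) + 1) (D j (D i f)))
    (fun n => (integrable_heatIntegral (by positivity) _).aestronglyMeasurable) _
    (Eventually.of_forall fun x => (tendsto_integral_heat j (D i f) x).comp
      (tendsto_atTop_add_const_right _ 1 tendsto_natCast_atTop_atTop))).trans ?_
  exact liminf_le_of_frequently_le' (Eventually.of_forall fun n => hS _ (by positivity)).frequently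

end MainEstimate

end BiotSavart

/-- For `p ∈ (1,2)` and `ω` Schwartz, the Biot–Savart velocity
`u = K * ω` is `C¹`, is divergence free, has curl `ω`, and its partial derivatives
satisfy `‖∂ᵢ u_j‖_{L^p} ≤ C ‖ω‖_{L^p}` with `C` depending only on `p`. -/
theorem biotSavart_gradient_estimate (p : ℝ≥0∞) (hp1 : 1 < p) (hp2 : p < 2) :
    ∃ C : ℝ, 0 < C ∧ ∀ ω : SchwartzMap R2 ℝ,
      ContDiff ℝ 1 (biotSavart ω) ∧
      (∀ x : R2,
        pd 0 (fun y => biotSavart ω y 0) x + pd 1 (fun y => biotSavart ω y 1) x = 0 ∧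
        pd 0 (fun y => biotSavart ω y 1) x - pd 1 (fun y => biotSavart ω y 0) x = ω x) ∧
      ∀ i j : Fin 2,
        eLpNorm (pd i (fun y => biotSavart ω y j)) p volume ≤
          ENNReal.ofReal C * eLpNorm (⇑ω) p volume := by
  have hp : p ≠ ∞ := (hp2.trans ENNReal.ofNat_lt_top).ne
  have hP : 1 < p.toReal := by simpa using (ENNReal.toReal_lt_toReal ENNReal.one_ne_top hp).2 hp1
  have hP2 : p.toReal < 2 := by
    simpa using (ENNReal.toReal_lt_toReal hp ENNReal.ofNat_ne_top).2 hp2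
  obtain ⟨C, hC, h⟩ := BiotSavart.exists_eLpNorm_conv_le hP hP2
  rw [ENNReal.ofReal_toReal hp] at h
  refine ⟨C, hC, fun ω => ⟨BiotSavart.contDiff_biotSavart ω, BiotSavart.biotSavart_div_curl ω,
    fun i j => ?_⟩⟩
  fin_cases j
  · exact (BiotSavart.pd_biotSavart_zero i ω) ▸ h ω i 1
  · have := BiotSavart.pd_biotSavart_one i ω
    simp only [Fin.mk_one]
    rw [this, eLpNorm_neg]
    exact h ω i 0

end
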